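/- Let G=(V,E) be a supply graph and H=(V,D) a demand graph such that G+H is planar, and let x be a feasible solution to the nonnegative cycle LP. Then there exists a set D' ⊆ D that is a feasible NonNegativeCycles solution (i.e., |C∩D'| ≤ |C∩E| for every cycle C of G+H) with |D'| ≥ (1/16)·Σ_{e∈D} x_e. -/

import Mathlib

open scoped Classical

noncomputable section

/-- The edge set of a simple closed walk in the multigraph with endpoint map `ends`. -/
def IsCycle {V ε : Type} (ends : ε → Sym2 V) (C : Finset ε) : Prop :=
  ∃ (n : ℕ) (v : Fin (n + 1) → V) (e : Fin (n + 1) → ε),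
    Function.Injective v ∧ Function.Injective e ∧
    (∀ i, ends (e i) = s(v i, v (i + 1))) ∧
    C = Finset.image e Finset.univ

/-- The edge set of a simple (open) path. -/
def IsPath {V ε : Type} (ends : ε → Sym2 V) (P : Finset ε) : Prop :=
  ∃ (n : ℕ) (v : Fin (n + 1) → V) (e : Fin n → ε),
    Function.Injective v ∧ Function.Injective e ∧
    (∀ i : Fin n, ends (e i) = s(v i.castSucc, v i.succ)) ∧
    P = Finset.image e Finset.univ

/-- The cut `δ(U)`: edges with exactly one endpoint in `U`. -/
def cutF {V ε : Type} [Fintype ε] (ends : ε → Sym2 V) (U : Set V) : Finset ε :=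
  Finset.univ.filter (fun e => ∃ a b, ends e = s(a, b) ∧ a ∈ U ∧ b ∉ U)

/-- `U` is nonempty and induces a connected subgraph. -/
def ConnectedOn {V ε : Type} (ends : ε → Sym2 V) (U : Set V) : Prop :=
  U.Nonempty ∧ ∀ a ∈ U, ∀ b ∈ U,
    Relation.ReflTransGen (fun x y => x ∈ U ∧ y ∈ U ∧ ∃ e, ends e = s(x, y)) a b

/-- The multigraph is connected. -/
def MGConnected {V ε : Type} (ends : ε → Sym2 V) : Prop :=
  ConnectedOn ends Set.univ

/-- `δ(U)` is a simple cut: both sides induce connected subgraphs. -/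
def IsSimpleCut {V ε : Type} (ends : ε → Sym2 V) (U : Set V) : Prop :=
  ConnectedOn ends U ∧ ConnectedOn ends Uᶜ

/-- A `D`-cycle: a cycle containing exactly one demand edge. -/
def IsDCycle {V ε : Type} [DecidableEq ε] (ends : ε → Sym2 V) (Dem : Finset ε)
    (C : Finset ε) : Prop :=
  IsCycle ends C ∧ (C ∩ Dem).card = 1

/-- A `D`-cut: a simple cut containing exactly one demand edge. -/
def IsDCut {V ε : Type} [Fintype ε] [DecidableEq ε] (ends : ε → Sym2 V) (Dem : Finset ε)
    (U : Set V) : Prop :=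
  IsSimpleCut ends U ∧ (cutF ends U ∩ Dem).card = 1

/-- Planarity of a multigraph: there is a drawing in the plane with injective vertex
positions and arcs for the edges that are internally disjoint. -/
def IsPlanar {V ε : Type} (ends : ε → Sym2 V) : Prop :=
  ∃ (pos : V → ℝ × ℝ) (arc : ε → ℝ → ℝ × ℝ),
    Function.Injective pos ∧
    (∀ e, ContinuousOn (arc e) (Set.Icc 0 1)) ∧
    (∀ e a b, ends e = s(a, b) →
      (arc e 0 = pos a ∧ arc e 1 = pos b) ∨ (arc e 0 = pos b ∧ arc e 1 = pos a)) ∧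
    (∀ e, Set.InjOn (arc e) (Set.Ico 0 1)) ∧
    (∀ e f, e ≠ f → ∀ s ∈ Set.Ioo (0:ℝ) 1, ∀ t ∈ Set.Icc (0:ℝ) 1, arc e s ≠ arc f t) ∧
    (∀ e, ∀ s ∈ Set.Ioo (0:ℝ) 1, ∀ w, arc e s ≠ pos w)

theorem Complex.exists_continuous_log {X : Type} [TopologicalSpace X] [SimplyConnectedSpace X]
    [LocallyPathConnectedSpace X] {f : X → ℂ} (hf : Continuous f) (h0 : ∀ x, f x ≠ 0) :
    ∃ g : X → ℂ, Continuous g ∧ ∀ x, Complex.exp (g x) = f x := by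
  obtain ⟨x₀⟩ : Nonempty X := inferInstance
  obtain ⟨F, ⟨-, hF⟩, -⟩ := Complex.isCoveringMapOn_exp.existsUnique_continuousMap_lifts
    ⟨f, hf⟩ (Complex.exp_log (h0 x₀)) h0
  exact ⟨F, F.continuous, fun x => congrFun hF x⟩

theorem Complex.log_variation_unique {g₁ g₂ : ℝ → ℂ} (h₁ : Continuous g₁) (h₂ : Continuous g₂)
    (K : ℂ) (h : ∀ s, Complex.exp (g₁ s) = K * Complex.exp (g₂ s)) :
    g₁ 1 - g₁ 0 = g₂ 1 - g₂ 0 := by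
  have key : g₁ = fun s => g₂ s + (g₁ 0 - g₂ 0) := by
    refine Complex.isCoveringMap_exp.eq_of_comp_eq h₁ (by fun_prop) ?_ 0 (by ring)
    funext s
    apply Subtype.ext
    have h0 := h 0
    have hs := h s
    simp only [Function.comp]
    rw [Complex.exp_add, Complex.exp_sub, hs, h0]
    field_simp [Complex.exp_ne_zero]
  have := congrFun key 1
  rw [this]; ring

theorem log_variation_cross {α β : ℝ → ℂ} (hα : Continuous α) (hβ : Continuous β)
    (hne : ∀ s t, α s ≠ β t) {A₀ A₁ B₀ B₁ : ℝ → ℂ}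
    (hA₀ : Continuous A₀) (hA₁ : Continuous A₁) (hB₀ : Continuous B₀) (hB₁ : Continuous B₁)
    (eA₀ : ∀ s, Complex.exp (A₀ s) = α s - β 0) (eA₁ : ∀ s, Complex.exp (A₁ s) = α s - β 1)
    (eB₀ : ∀ s, Complex.exp (B₀ s) = β s - α 0) (eB₁ : ∀ s, Complex.exp (B₁ s) = β s - α 1) :
    (A₀ 1 - A₀ 0) + (B₁ 1 - B₁ 0) = (B₀ 1 - B₀ 0) + (A₁ 1 - A₁ 0) := by
  obtain ⟨g, hg, eg⟩ := Complex.exists_continuous_log (X := ℝ × ℝ)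
    (f := fun q => α q.1 - β q.2) (by fun_prop) (fun q => sub_ne_zero.2 (hne _ _))
  have e1 := Complex.log_variation_unique (g₁ := A₀) (g₂ := fun s => g (s, 0)) hA₀ (by fun_prop) 1
    (fun s => by simp [eA₀, eg])
  have e2 := Complex.log_variation_unique (g₁ := A₁) (g₂ := fun s => g (s, 1)) hA₁ (by fun_prop) 1
    (fun s => by simp [eA₁, eg])
  have e3 := Complex.log_variation_unique (g₁ := B₀) (g₂ := fun s => g (0, s)) hB₀ (by fun_prop)
    (-1) (fun s => by simp [eB₀, eg])
  have e4 := Complex.log_variation_unique (g₁ := B₁) (g₂ := fun s => g (1, s)) hB₁ (by fun_prop)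
    (-1) (fun s => by simp [eB₁, eg])
  rw [e1, e2, e3, e4]; ring

/-- Any continuous drawing of the complete graph on five vertices has two edges without a common
endpoint whose images meet. -/
theorem no_almost_embedding_K5 (p : Fin 5 → ℂ) (hp : Function.Injective p)
    (γ : Fin 5 → Fin 5 → ℝ → ℂ)
    (hc : ∀ i j, i < j → Continuous (γ i j))
    (h0 : ∀ i j, i < j → γ i j 0 = p i) (h1 : ∀ i j, i < j → γ i j 1 = p j)
    (hv : ∀ i j, i < j → ∀ v, v ≠ i → v ≠ j → ∀ s, γ i j s ≠ p v)
    (hd : ∀ i j k l, i < j → k < l → i ≠ k → i ≠ l → j ≠ k → j ≠ l →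
      ∀ s t, γ i j s ≠ γ k l t) : False := by
  have hg : ∀ i j v, ∃ g : ℝ → ℂ, i < j → v ≠ i → v ≠ j →
      Continuous g ∧ ∀ s, Complex.exp (g s) = γ i j s - p v := by
    intro i j v
    by_cases h : i < j ∧ v ≠ i ∧ v ≠ j
    · obtain ⟨g, hg, eg⟩ := Complex.exists_continuous_log (X := ℝ) (f := fun s => γ i j s - p v)
        ((hc i j h.1).sub continuous_const) (fun s => sub_ne_zero.2 (hv i j h.1 v h.2.1 h.2.2 s))
      exact ⟨g, fun _ _ _ => ⟨hg, eg⟩⟩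
    · exact ⟨0, fun a b c => absurd ⟨a, b, c⟩ h⟩
  choose g hg using hg
  let σ : Fin 5 → Fin 5 → ℤ := fun u v => if u < v then -1 else 1
  let L : Fin 5 → Fin 5 → ℂ := fun u v =>
    if u < v then Complex.log (p u - p v) else Complex.log (p v - p u) + Real.pi * Complex.I
  have hL : ∀ u v, u ≠ v → Complex.exp (L u v) = p u - p v := by
    intro u v huv
    have hne : p u ≠ p v := fun h => huv (hp h)
    by_cases h : u < v
    · simp only [L, h, if_true]
      exact Complex.exp_log (sub_ne_zero.2 hne)
    · simp only [L, h, if_false]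
      rw [Complex.exp_add, Complex.exp_log (sub_ne_zero.2 hne.symm), Complex.exp_pi_mul_I]
      ring
  have hD : ∀ u v, u ≠ v → L u v - L v u = σ u v * (Real.pi * Complex.I) := by
    intro u v huv
    rcases lt_or_gt_of_ne huv with h | h
    · simp only [L, σ, h, not_lt_of_gt h, if_true, if_false]; push_cast; ring
    · simp only [L, σ, h, not_lt_of_gt h, if_true, if_false]; push_cast; ring
  have hn : ∀ i j v, ∃ n : ℤ, i < j → v ≠ i → v ≠ j →
      g i j v 1 - g i j v 0 = L j v - L i v + n * (2 * Real.pi * Complex.I) := by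
    intro i j v
    by_cases h : i < j ∧ v ≠ i ∧ v ≠ j
    · obtain ⟨-, eg⟩ := hg i j v h.1 h.2.1 h.2.2
      have : Complex.exp (g i j v 1 - g i j v 0) = Complex.exp (L j v - L i v) := by
        rw [Complex.exp_sub, Complex.exp_sub, eg, eg, h0 i j h.1, h1 i j h.1,
          hL _ _ h.2.2.symm, hL _ _ h.2.1.symm]
      obtain ⟨n, hn⟩ := Complex.exp_eq_exp_iff_exists_int.1 this
      exact ⟨n, fun _ _ _ => hn⟩
    · exact ⟨0, fun a b c => absurd ⟨a, b, c⟩ h⟩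
  choose n hn using hn
  have key : ∀ a b c d, a < b → c < d → a ≠ c → a ≠ d → b ≠ c → b ≠ d →
      2 * (n a b c + n c d b - n c d a - n a b d) + σ b c - σ a c - σ b d + σ a d = 0 := by
    intro a b c d hab hcd hac had hbc hbd
    obtain ⟨cA₀, eA₀⟩ := hg a b c hab hac.symm hbc.symm
    obtain ⟨cA₁, eA₁⟩ := hg a b d hab had.symm hbd.symm
    obtain ⟨cB₀, eB₀⟩ := hg c d a hcd hac had
    obtain ⟨cB₁, eB₁⟩ := hg c d b hcd hbc hbd
    have := log_variation_cross (hc a b hab) (hc c d hcd)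
      (hd a b c d hab hcd hac had hbc hbd) cA₀ cA₁ cB₀ cB₁
      (by simpa [h0 c d hcd] using eA₀) (by simpa [h1 c d hcd] using eA₁)
      (by simpa [h0 a b hab] using eB₀) (by simpa [h1 a b hab] using eB₁)
    rw [hn a b c hab hac.symm hbc.symm, hn a b d hab had.symm hbd.symm, hn c d a hcd hac had,
      hn c d b hcd hbc hbd] at this
    have hpi : (Real.pi * Complex.I : ℂ) ≠ 0 := by simp [Real.pi_ne_zero]
    have e1 := hD b c hbc
    have e2 := hD a c hac
    have e3 := hD b d hbd
    have e4 := hD a d had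
    have : ((2 * (n a b c + n c d b - n c d a - n a b d) + σ b c - σ a c - σ b d + σ a d : ℤ) : ℂ)
        * (Real.pi * Complex.I) = 0 := by
      push_cast
      linear_combination this - e1 + e2 + e3 - e4
    exact_mod_cast (mul_eq_zero.1 this).resolve_right hpi
  have k1 := key 0 1 2 3 (by decide) (by decide) (by decide) (by decide) (by decide) (by decide)
  have k2 := key 0 1 2 4 (by decide) (by decide) (by decide) (by decide) (by decide) (by decide)
  have k3 := key 0 1 3 4 (by decide) (by decide) (by decide) (by decide) (by decide) (by decide)
  have k4 := key 0 2 1 3 (by decide) (by decide) (by decide) (by decide) (by decide) (by decide)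
  have k5 := key 0 2 1 4 (by decide) (by decide) (by decide) (by decide) (by decide) (by decide)
  have k6 := key 0 2 3 4 (by decide) (by decide) (by decide) (by decide) (by decide) (by decide)
  have k7 := key 0 3 1 2 (by decide) (by decide) (by decide) (by decide) (by decide) (by decide)
  have k8 := key 0 3 1 4 (by decide) (by decide) (by decide) (by decide) (by decide) (by decide)
  have k9 := key 0 3 2 4 (by decide) (by decide) (by decide) (by decide) (by decide) (by decide)
  have k10 := key 0 4 1 2 (by decide) (by decide) (by decide) (by decide) (by decide) (by decide)
  have k11 := key 0 4 1 3 (by decide) (by decide) (by decide) (by decide) (by decide) (by decide)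
  have k12 := key 0 4 2 3 (by decide) (by decide) (by decide) (by decide) (by decide) (by decide)
  have k13 := key 1 2 3 4 (by decide) (by decide) (by decide) (by decide) (by decide) (by decide)
  have k14 := key 1 3 2 4 (by decide) (by decide) (by decide) (by decide) (by decide) (by decide)
  have k15 := key 1 4 2 3 (by decide) (by decide) (by decide) (by decide) (by decide) (by decide)
  simp [σ] at k1 k2 k3 k4 k5 k6 k7 k8 k9 k10 k11 k12 k13 k14 k15
  omega

/-- Some edge joins `A` to `B`. -/
def Touch {V ε : Type} (ends : ε → Sym2 V) (A B : Set V) : Prop :=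
  ∃ e, ∃ a ∈ A, ∃ b ∈ B, ends e = s(a, b)

theorem Touch.symm {V ε : Type} {ends : ε → Sym2 V} {A B : Set V} (h : Touch ends A B) :
    Touch ends B A := by
  obtain ⟨e, a, ha, b, hb, he⟩ := h
  exact ⟨e, b, hb, a, ha, by rw [he, Sym2.eq_swap]⟩

theorem Touch.mono {V ε : Type} {ends : ε → Sym2 V} {A B A' B' : Set V} (h : Touch ends A B)
    (hA : A ⊆ A') (hB : B ⊆ B') : Touch ends A' B' := by
  obtain ⟨e, a, ha, b, hb, he⟩ := h
  exact ⟨e, a, hA ha, b, hB hb, he⟩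

theorem touch_union_left {V ε : Type} {ends : ε → Sym2 V} {A B C : Set V} :
    Touch ends (A ∪ B) C ↔ Touch ends A C ∨ Touch ends B C := by
  constructor
  · rintro ⟨e, a, ha | ha, b, hb, he⟩
    · exact Or.inl ⟨e, a, ha, b, hb, he⟩
    · exact Or.inr ⟨e, a, ha, b, hb, he⟩
  · rintro (h | h)
    · exact h.mono Set.subset_union_left le_rfl
    · exact h.mono Set.subset_union_right le_rfl

theorem ConnectedOn.union {V ε : Type} {ends : ε → Sym2 V} {A B : Set V}
    (hA : ConnectedOn ends A) (hB : ConnectedOn ends B) (h : Touch ends A B) :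
    ConnectedOn ends (A ∪ B) := by
  obtain ⟨e, a, ha, b, hb, he⟩ := h
  have mA : ∀ x ∈ A, ∀ y ∈ A, Relation.ReflTransGen
      (fun x y => x ∈ A ∪ B ∧ y ∈ A ∪ B ∧ ∃ e, ends e = s(x, y)) x y := fun x hx y hy =>
    Relation.ReflTransGen.mono (fun u v h => ⟨Or.inl h.1, Or.inl h.2.1, h.2.2⟩) _ _ (hA.2 x hx y hy)
  have mB : ∀ x ∈ B, ∀ y ∈ B, Relation.ReflTransGen
      (fun x y => x ∈ A ∪ B ∧ y ∈ A ∪ B ∧ ∃ e, ends e = s(x, y)) x y := fun x hx y hy =>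
    Relation.ReflTransGen.mono (fun u v h => ⟨Or.inr h.1, Or.inr h.2.1, h.2.2⟩) _ _ (hB.2 x hx y hy)
  have hab : Relation.ReflTransGen
      (fun x y => x ∈ A ∪ B ∧ y ∈ A ∪ B ∧ ∃ e, ends e = s(x, y)) a b :=
    .single ⟨Or.inl ha, Or.inr hb, e, he⟩
  have hba : Relation.ReflTransGen
      (fun x y => x ∈ A ∪ B ∧ y ∈ A ∪ B ∧ ∃ e, ends e = s(x, y)) b a :=
    .single ⟨Or.inr hb, Or.inl ha, e, by rw [he, Sym2.eq_swap]⟩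
  refine ⟨hA.1.mono Set.subset_union_left, ?_⟩
  rintro x (hx | hx) y (hy | hy)
  · exact mA x hx y hy
  · exact ((mA x hx a ha).trans hab).trans (mB b hb y hy)
  · exact ((mB x hx b hb).trans hba).trans (mA a ha y hy)
  · exact mB x hx y hy

/-- The part of a drawing that is spanned by the vertices in `S`. -/
def drawn {V ε : Type} (ends : ε → Sym2 V) (pos : V → ℝ × ℝ) (arc : ε → ℝ → ℝ × ℝ)
    (S : Set V) : Set (ℝ × ℝ) :=
  {q | (∃ v ∈ S, pos v = q) ∨
    ∃ e a b, ends e = s(a, b) ∧ a ∈ S ∧ b ∈ S ∧ ∃ t ∈ Set.Icc (0 : ℝ) 1, arc e t = q}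

theorem joinedIn_drawn {V ε : Type} {ends : ε → Sym2 V} {pos : V → ℝ × ℝ}
    {arc : ε → ℝ → ℝ × ℝ} (hc : ∀ e, ContinuousOn (arc e) (Set.Icc 0 1))
    (he : ∀ e a b, ends e = s(a, b) →
      (arc e 0 = pos a ∧ arc e 1 = pos b) ∨ (arc e 0 = pos b ∧ arc e 1 = pos a))
    {S : Set V} (hS : ConnectedOn ends S) {a b : V} (ha : a ∈ S) (hb : b ∈ S) :
    JoinedIn (drawn ends pos arc S) (pos a) (pos b) := by
  induction hS.2 a ha b hb with
  | refl => exact JoinedIn.refl (Or.inl ⟨a, ha, rfl⟩)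
  | @tail c d _ hcd ih =>
    obtain ⟨hcS, hdS, e, hecd⟩ := hcd
    refine (ih hcS).trans ?_
    have himg : arc e '' Set.Icc (0 : ℝ) 1 ⊆ drawn ends pos arc S := by
      rintro q ⟨t, ht, rfl⟩
      exact Or.inr ⟨e, c, d, hecd, hcS, hdS, t, ht, rfl⟩
    rcases he e c d hecd with ⟨h0, h1⟩ | ⟨h0, h1⟩
    · exact (JoinedIn.ofLine (hc e) h0 h1 himg)
    · exact (JoinedIn.ofLine (hc e) h0 h1 himg).symm

theorem disjoint_drawn {V ε : Type} {ends : ε → Sym2 V} {pos : V → ℝ × ℝ}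
    {arc : ε → ℝ → ℝ × ℝ} (hpos : Function.Injective pos)
    (he : ∀ e a b, ends e = s(a, b) →
      (arc e 0 = pos a ∧ arc e 1 = pos b) ∨ (arc e 0 = pos b ∧ arc e 1 = pos a))
    (hef : ∀ e f, e ≠ f → ∀ s ∈ Set.Ioo (0:ℝ) 1, ∀ t ∈ Set.Icc (0:ℝ) 1, arc e s ≠ arc f t)
    (hev : ∀ e, ∀ s ∈ Set.Ioo (0:ℝ) 1, ∀ w, arc e s ≠ pos w)
    {S T : Set V} (hST : Disjoint S T) :
    Disjoint (drawn ends pos arc S) (drawn ends pos arc T) := by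
  have hends : ∀ {U : Set V} {e a b}, ends e = s(a, b) → a ∈ U → b ∈ U →
      ∀ t ∈ Set.Icc (0 : ℝ) 1, t ∈ Set.Ioo (0 : ℝ) 1 ∨ ∃ v ∈ U, pos v = arc e t := by
    intro U e a b h ha hb t ht
    rcases eq_or_lt_of_le ht.1 with h0 | h0
    · subst h0
      rcases he e a b h with h' | h'
      · exact Or.inr ⟨a, ha, h'.1.symm⟩
      · exact Or.inr ⟨b, hb, h'.1.symm⟩
    · rcases eq_or_lt_of_le ht.2 with h1 | h1
      · subst h1
        rcases he e a b h with h' | h'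
        · exact Or.inr ⟨b, hb, h'.2.symm⟩
        · exact Or.inr ⟨a, ha, h'.2.symm⟩
      · exact Or.inl ⟨h0, h1⟩
  have hvv : ∀ v ∈ S, ∀ w ∈ T, pos v ≠ pos w := fun v hv w hw h =>
    Set.disjoint_left.1 hST hv (hpos h ▸ hw)
  rw [Set.disjoint_left]
  rintro q (⟨v, hv, rfl⟩ | ⟨e, a, b, hab, ha, hb, t, ht, rfl⟩)
    (⟨w, hw, hq⟩ | ⟨f, c, d, hcd, hcT, hdT, s, hs, hq⟩)
  · exact hvv v hv w hw hq.symm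
  · rcases hends hcd hcT hdT s hs with hs' | ⟨w, hw, h⟩
    · exact hev f s hs' v hq
    · exact hvv v hv w hw (hq.symm.trans h.symm)
  · rcases hends hab ha hb t ht with ht' | ⟨v, hv, h⟩
    · exact hev e t ht' w hq.symm
    · exact hvv v hv w hw (h.trans hq.symm)
  · have hne : e ≠ f := by
      rintro rfl
      rw [hab, Sym2.eq_iff] at hcd
      rcases hcd with h | h
      · exact Set.disjoint_left.1 hST ha (h.1 ▸ hcT)
      · exact Set.disjoint_left.1 hST ha (h.1 ▸ hdT)
    rcases hends hab ha hb t ht with ht' | ⟨v, hv, h⟩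
    · exact hef e f hne t ht' s hs hq.symm
    · rcases hends hcd hcT hdT s hs with hs' | ⟨w, hw, h'⟩
      · exact hef f e hne.symm s hs' t ht hq
      · exact hvv v hv w hw (h.trans (hq.symm.trans h'.symm))

/-- A planar multigraph has no minor that is the complete graph on five vertices. -/
theorem IsPlanar.no_K5_minor {V ε : Type} {ends : ε → Sym2 V} (hpl : IsPlanar ends)
    (B : Fin 5 → Set V) (hconn : ∀ i, ConnectedOn ends (B i))
    (hdisj : ∀ i j, i ≠ j → Disjoint (B i) (B j))
    (htouch : ∀ i j, i ≠ j → Touch ends (B i) (B j)) : False := by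
  obtain ⟨pos, arc, hpos, hc, he, -, hef, hev⟩ := hpl
  choose r hr using fun i => (hconn i).1
  have hr_inj : Function.Injective r := by
    intro i j hij
    by_contra hne
    exact Set.disjoint_left.1 (hdisj i j hne) (hr i) (hij ▸ hr j)
  have hJ : ∀ i j, ∃ γ : ℝ → ℝ × ℝ, i < j → Continuous γ ∧ γ 0 = pos (r i) ∧ γ 1 = pos (r j) ∧
      ∀ s, γ s ∈ drawn ends pos arc (B i ∪ B j) := by
    intro i j
    by_cases h : i < j
    · have := joinedIn_drawn hc he ((hconn i).union (hconn j) (htouch i j h.ne))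
        (Or.inl (hr i)) (Or.inr (hr j))
      obtain ⟨γ, hγ⟩ := this
      refine ⟨γ.extend, fun _ => ⟨γ.continuous_extend, γ.extend_zero, γ.extend_one, fun s => ?_⟩⟩
      have : γ.extend s ∈ Set.range γ := by
        rw [← γ.extend_range]; exact ⟨s, rfl⟩
      obtain ⟨t, ht⟩ := this
      rw [← ht]; exact hγ t
    · exact ⟨0, fun h' => absurd h' h⟩
  choose γ hγ using hJ
  let φ := Complex.equivRealProdCLM.symm
  have hvdr : ∀ v, pos (r v) ∈ drawn ends pos arc (B v) := fun v => Or.inl ⟨_, hr v, rfl⟩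
  have hdd : ∀ {S T : Set V}, Disjoint S T → ∀ x ∈ drawn ends pos arc S,
      ∀ y ∈ drawn ends pos arc T, x ≠ y := fun h x hx y hy hxy =>
    Set.disjoint_left.1 (disjoint_drawn hpos he hef hev h) hx (hxy ▸ hy)
  refine no_almost_embedding_K5 (fun i => φ (pos (r i)))
    (fun i j h => hr_inj (hpos (φ.injective h))) (fun i j s => φ (γ i j s))
    (fun i j h => φ.continuous.comp (hγ i j h).1) (fun i j h => by rw [(hγ i j h).2.1])
    (fun i j h => by rw [(hγ i j h).2.2.1]) ?_ ?_
  · intro i j h v hvi hvj s hs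
    refine hdd ?_ _ ((hγ i j h).2.2.2 s) _ (hvdr v) (φ.injective hs)
    exact Set.disjoint_union_left.2 ⟨hdisj _ _ hvi.symm, hdisj _ _ hvj.symm⟩
  · intro i j k l hij hkl hik hil hjk hjl s t hst
    refine hdd ?_ _ ((hγ i j hij).2.2.2 s) _ ((hγ k l hkl).2.2.2 t) (φ.injective hst)
    exact Set.disjoint_union_left.2 ⟨Set.disjoint_union_right.2 ⟨hdisj _ _ hik, hdisj _ _ hil⟩,
      Set.disjoint_union_right.2 ⟨hdisj _ _ hjk, hdisj _ _ hjl⟩⟩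

/-- The sum of the degrees of the graph with adjacency `R` induced on a finite family. -/
def degSum {V : Type} (R : Set V → Set V → Prop) (P : Finset (Set V)) : ℕ :=
  ∑ A ∈ P, (P.filter fun C => C ≠ A ∧ R A C).card

theorem degSum_insert {V : Type} {R : Set V → Set V → Prop} (hR : ∀ a b, R a b → R b a)
    {P : Finset (Set V)} {X : Set V} (hX : X ∉ P) :
    degSum R (insert X P) = degSum R P + 2 * (P.filter fun C => R X C).card := by
  have h1 : ((insert X P).filter fun C => C ≠ X ∧ R X C) = P.filter fun C => R X C := by
    ext C
    simp only [Finset.mem_filter, Finset.mem_insert]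
    constructor
    · rintro ⟨h | h, h1, h2⟩
      · exact absurd h h1
      · exact ⟨h, h2⟩
    · rintro ⟨h, h2⟩
      exact ⟨Or.inr h, fun h' => hX (h' ▸ h), h2⟩
  have h2 : ∀ A ∈ P, ((insert X P).filter fun C => C ≠ A ∧ R A C).card
      = (P.filter fun C => C ≠ A ∧ R A C).card + if R X A then 1 else 0 := by
    intro A hA
    have hXA : X ≠ A := fun h => hX (h ▸ hA)
    rw [Finset.filter_insert]
    by_cases h : R X A
    · rw [if_pos ⟨hXA, hR _ _ h⟩, if_pos h, Finset.card_insert_of_notMem]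
      exact fun h' => hX (Finset.mem_filter.1 h').1
    · rw [if_neg (fun h' => h (hR _ _ h'.2)), if_neg h, add_zero]
  rw [degSum, Finset.sum_insert hX, h1, Finset.sum_congr rfl h2, Finset.sum_add_distrib,
    ← Finset.card_filter, degSum]
  ring

/-- Pairwise disjoint sets of vertices, each inducing a connected subgraph. -/
def DisjointConnected {V ε : Type} (ends : ε → Sym2 V) (K : Finset (Set V)) : Prop :=
  (∀ A ∈ K, ConnectedOn ends A) ∧ ∀ A ∈ K, ∀ B ∈ K, A ≠ B → Disjoint A B

/-- `A` is contained in the union of `K` and contains a member of `K`. -/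
def Between {V : Type} (K : Finset (Set V)) (A : Set V) : Prop :=
  (∀ x ∈ A, ∃ B ∈ K, x ∈ B) ∧ ∃ B ∈ K, B ⊆ A

theorem Between.trans {V : Type} {K L : Finset (Set V)} (hL : ∀ B ∈ L, Between K B) {A : Set V}
    (hA : Between L A) : Between K A := by
  refine ⟨fun x hx => ?_, ?_⟩
  · obtain ⟨B, hB, hxB⟩ := hA.1 x hx
    exact (hL B hB).1 x hxB
  · obtain ⟨B, hB, hBA⟩ := hA.2
    obtain ⟨C, hC, hCB⟩ := (hL B hB).2
    exact ⟨C, hC, hCB.trans hBA⟩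

theorem between_of_mem {V : Type} {K : Finset (Set V)} {A : Set V} (hA : A ∈ K) : Between K A :=
  ⟨fun _ hx => ⟨A, hA, hx⟩, A, hA, le_rfl⟩

/-- The complete graph on `t` vertices is a minor, with branch sets formed from members of `K`. -/
def HasCliqueMinor {V ε : Type} (ends : ε → Sym2 V) (K : Finset (Set V)) (t : ℕ) : Prop :=
  ∃ B : Fin t → Set V, (∀ i, ConnectedOn ends (B i)) ∧
    (∀ i j, i ≠ j → Disjoint (B i) (B j)) ∧ (∀ i j, i ≠ j → Touch ends (B i) (B j)) ∧
    ∀ i, Between K (B i)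

/-- Contracting edges that lie in few triangles keeps the average degree high. -/
theorem exists_contraction {V ε : Type} {ends : ε → Sym2 V} (d n : ℕ) :
    ∀ K : Finset (Set V), K.card = n → K.Nonempty → DisjointConnected ends K →
    2 * d * K.card ≤ degSum (Touch ends) K →
    ∃ L : Finset (Set V), L.Nonempty ∧ DisjointConnected ends L ∧ (∀ B ∈ L, Between K B) ∧
      2 * d * L.card ≤ degSum (Touch ends) L ∧
      ∀ A ∈ L, ∀ B ∈ L, A ≠ B → Touch ends A B →
        d ≤ (((L.erase A).erase B).filter fun C => Touch ends A C ∧ Touch ends B C).card := by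
  induction n using Nat.strong_induction_on with
  | _ n ih =>
  intro K hn hK hdc hdeg
  by_cases hgood : ∀ A ∈ K, ∀ B ∈ K, A ≠ B → Touch ends A B →
        d ≤ (((K.erase A).erase B).filter fun C => Touch ends A C ∧ Touch ends B C).card
  · exact ⟨K, hK, hdc, fun B hB => between_of_mem hB, hdeg, hgood⟩
  push Not at hgood
  obtain ⟨A, hA, B, hB, hAB, hT, hlt⟩ := hgood
  set P := (K.erase A).erase B with hP
  have hsym : ∀ a b, Touch ends a b → Touch ends b a := fun a b h => h.symm
  have hBA : B ∈ K.erase A := Finset.mem_erase.2 ⟨hAB.symm, hB⟩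
  have hKins : K = insert A (insert B P) := by
    rw [hP, Finset.insert_erase hBA, Finset.insert_erase hA]
  have hBP : B ∉ P := Finset.notMem_erase _ _
  have hAP : A ∉ insert B P := by
    rw [hP, Finset.insert_erase hBA]; exact Finset.notMem_erase _ _
  have hPK : ∀ C ∈ P, C ∈ K ∧ C ≠ A ∧ C ≠ B := fun C hC => by
    have h1 := Finset.mem_erase.1 hC
    have h2 := Finset.mem_erase.1 h1.2
    exact ⟨h2.2, h2.1, h1.1⟩
  have hdisjP : ∀ C ∈ P, Disjoint (A ∪ B) C := fun C hC => by
    obtain ⟨h1, h2, h3⟩ := hPK C hC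
    exact Set.disjoint_union_left.2 ⟨hdc.2 _ hA _ h1 h2.symm, hdc.2 _ hB _ h1 h3.symm⟩
  have hUP : A ∪ B ∉ P := by
    intro h
    obtain ⟨x, hx⟩ := (hdc.1 A hA).1
    exact Set.disjoint_left.1 (hdisjP _ h) (Or.inl hx) (Or.inl hx)
  have hs1 : degSum (Touch ends) K = degSum (Touch ends) P
      + 2 * (P.filter fun C => Touch ends B C).card
      + 2 * ((P.filter fun C => Touch ends A C).card + 1) := by
    conv_lhs => rw [hKins]
    rw [degSum_insert hsym hAP, degSum_insert hsym hBP, Finset.filter_insert, if_pos hT,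
      Finset.card_insert_of_notMem fun h => hBP (Finset.mem_filter.1 h).1]
  have hs2 : degSum (Touch ends) (insert (A ∪ B) P) = degSum (Touch ends) P
      + 2 * (P.filter fun C => Touch ends A C ∨ Touch ends B C).card := by
    rw [degSum_insert hsym hUP]
    simp only [touch_union_left]
  have hs3 : (P.filter fun C => Touch ends A C ∨ Touch ends B C).card
      + (P.filter fun C => Touch ends A C ∧ Touch ends B C).card
      = (P.filter fun C => Touch ends A C).card + (P.filter fun C => Touch ends B C).card := by
    rw [Finset.filter_or, Finset.filter_and, Finset.card_union_add_card_inter]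
  have hc1 : K.card = P.card + 2 := by
    conv_lhs => rw [hKins]
    rw [Finset.card_insert_of_notMem hAP, Finset.card_insert_of_notMem hBP]
  have hc2 : (insert (A ∪ B) P).card = P.card + 1 := Finset.card_insert_of_notMem hUP
  have hbet : ∀ C ∈ insert (A ∪ B) P, Between K C := by
    intro C hC
    rcases Finset.mem_insert.1 hC with rfl | hC
    · refine ⟨?_, A, hA, Set.subset_union_left⟩
      rintro x (hx | hx)
      · exact ⟨A, hA, hx⟩
      · exact ⟨B, hB, hx⟩
    · exact between_of_mem (hPK C hC).1
  have hdc' : DisjointConnected ends (insert (A ∪ B) P) := by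
    constructor
    · intro C hC
      rcases Finset.mem_insert.1 hC with rfl | hC
      · exact (hdc.1 A hA).union (hdc.1 B hB) hT
      · exact hdc.1 C (hPK C hC).1
    · intro C hC D hD hCD
      rcases Finset.mem_insert.1 hC with rfl | hC <;> rcases Finset.mem_insert.1 hD with rfl | hD
      · exact absurd rfl hCD
      · exact hdisjP D hD
      · exact (hdisjP C hC).symm
      · exact hdc.2 C (hPK C hC).1 D (hPK D hD).1 hCD
  obtain ⟨L, h1, h2, h3, h4, h5⟩ := ih (P.card + 1) (by omega) _ hc2
    (Finset.insert_nonempty _ _) hdc' (by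
      rw [hc2]
      rw [hc1] at hdeg
      have : 2 * d * (P.card + 2) = 2 * d * (P.card + 1) + 2 * d := by ring
      omega)
  exact ⟨L, h1, h2, fun C hC => (h3 C hC).trans hbet, h4, h5⟩

theorem hasCliqueMinor_succ {V ε : Type} {ends : ε → Sym2 V} {d t : ℕ} (hd : 1 ≤ d)
    (ih : ∀ K : Finset (Set V), K.Nonempty → DisjointConnected ends K →
      (∀ A ∈ K, d ≤ (K.filter fun C => C ≠ A ∧ Touch ends A C).card) → HasCliqueMinor ends K t)
    (K : Finset (Set V)) (hK : K.Nonempty) (hdc : DisjointConnected ends K)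
    (hdeg : ∀ A ∈ K, 2 * d ≤ (K.filter fun C => C ≠ A ∧ Touch ends A C).card) :
    HasCliqueMinor ends K (t + 1) := by
  obtain ⟨L, hL, hdcL, hbet, hsum, htri⟩ := exists_contraction d K.card K rfl hK hdc (by
    rw [degSum, mul_comm, ← smul_eq_mul]
    exact Finset.card_nsmul_le_sum _ _ _ hdeg)
  obtain ⟨A, hA, hAne⟩ : ∃ A ∈ L, (L.filter fun C => C ≠ A ∧ Touch ends A C).Nonempty := by
    by_contra! h
    have : degSum (Touch ends) L = 0 := Finset.sum_eq_zero fun A hA => by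
      rw [h A hA, Finset.card_empty]
    have h2 : 0 < 2 * d * L.card := by have := hL.card_pos; positivity
    omega
  set N := L.filter fun C => C ≠ A ∧ Touch ends A C with hN
  have hNL : ∀ C ∈ N, C ∈ L ∧ C ≠ A ∧ Touch ends A C := fun C hC => Finset.mem_filter.1 hC
  obtain ⟨B, hBc, hBd, hBt, hBb⟩ := ih N hAne
    ⟨fun C hC => hdcL.1 C (hNL C hC).1, fun C hC D hD => hdcL.2 C (hNL C hC).1 D (hNL D hD).1⟩
    (by
      intro C hC
      obtain ⟨h1, h2, h3⟩ := hNL C hC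
      refine (htri A hA C h1 h2.symm h3).trans (Finset.card_le_card ?_)
      intro D hD
      simp only [Finset.mem_filter, Finset.mem_erase] at hD
      exact Finset.mem_filter.2 ⟨Finset.mem_filter.2 ⟨hD.1.2.2, hD.1.2.1, hD.2.1⟩,
        hD.1.1, hD.2.2⟩)
  have hAB : ∀ i, Touch ends A (B i) := fun i => by
    obtain ⟨C, hC, hCB⟩ := (hBb i).2
    exact (hNL C hC).2.2.mono le_rfl hCB
  have hAdis : ∀ i, Disjoint A (B i) := fun i => by
    rw [Set.disjoint_left]
    intro x hx hxB
    obtain ⟨C, hC, hxC⟩ := (hBb i).1 x hxB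
    obtain ⟨h1, h2, -⟩ := hNL C hC
    exact Set.disjoint_left.1 (hdcL.2 A hA C h1 h2.symm) hx hxC
  refine ⟨Fin.cons A B, ?_, ?_, ?_, ?_⟩
  · intro i
    refine Fin.cases ?_ (fun i => ?_) i
    · exact hdcL.1 A hA
    · exact hBc i
  · intro i j
    refine Fin.cases ?_ (fun i => ?_) i <;> refine Fin.cases ?_ (fun j => ?_) j
    · exact fun h => absurd rfl h
    · exact fun _ => hAdis j
    · exact fun _ => (hAdis i).symm
    · exact fun h => hBd i j fun h' => h (by rw [h'])
  · intro i j
    refine Fin.cases ?_ (fun i => ?_) i <;> refine Fin.cases ?_ (fun j => ?_) j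
    · exact fun h => absurd rfl h
    · exact fun _ => hAB j
    · exact fun _ => (hAB i).symm
    · exact fun h => hBt i j fun h' => h (by rw [h'])
  · intro i
    refine Fin.cases ?_ (fun i => ?_) i
    · exact hbet A hA
    · exact ((hBb i).trans fun C hC => between_of_mem (hNL C hC).1).trans hbet

theorem hasCliqueMinor_two {V ε : Type} {ends : ε → Sym2 V}
    (K : Finset (Set V)) (hK : K.Nonempty) (hdc : DisjointConnected ends K)
    (hdeg : ∀ A ∈ K, 1 ≤ (K.filter fun C => C ≠ A ∧ Touch ends A C).card) :
    HasCliqueMinor ends K 2 := by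
  obtain ⟨A, hA⟩ := hK
  obtain ⟨C, hC⟩ := Finset.card_pos.1 (hdeg A hA)
  obtain ⟨hCK, hCA, hT⟩ := Finset.mem_filter.1 hC
  have hd := hdc.2 A hA C hCK hCA.symm
  refine ⟨![A, C], ?_, ?_, ?_, ?_⟩
  · simp [Fin.forall_fin_two, hdc.1 A hA, hdc.1 C hCK]
  · simp [Fin.forall_fin_two, hd, hd.symm]
  · simp [Fin.forall_fin_two, hT, hT.symm]
  · simp [Fin.forall_fin_two, between_of_mem hA, between_of_mem hCK]

/-- Disjoint connected sets in a planar multigraph: some set touches at most seven others. -/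
theorem IsPlanar.exists_degree_le_seven {V ε : Type} {ends : ε → Sym2 V} (hpl : IsPlanar ends)
    (K : Finset (Set V)) (hK : K.Nonempty) (hdc : DisjointConnected ends K) :
    ∃ A ∈ K, (K.filter fun C => C ≠ A ∧ Touch ends A C).card ≤ 7 := by
  by_contra! h
  obtain ⟨B, h1, h2, h3, -⟩ := hasCliqueMinor_succ (d := 4) (t := 4) (by norm_num)
    (hasCliqueMinor_succ (d := 2) (by norm_num)
      (hasCliqueMinor_succ (d := 1) le_rfl hasCliqueMinor_two)) K hK hdc h
  exact hpl.no_K5_minor B h1 h2 h3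

/-- The indicator vector modulo two of the two ends of an edge; it vanishes for a loop. -/
def inc {V : Type} (z : Sym2 V) : V → ZMod 2 :=
  Sym2.lift ⟨fun a b => Pi.single a 1 + Pi.single b 1, fun _ _ => add_comm _ _⟩ z

/-- The boundary modulo two of a set of edges. -/
def bd {V ε : Type} (ends : ε → Sym2 V) (Z : Finset ε) : V → ZMod 2 :=
  ∑ e ∈ Z, inc (ends e)

/-- The edge `z` has exactly one end in `U`. -/
def Crosses {V : Type} (z : Sym2 V) (U : Set V) : Prop :=
  ∃ a b, z = s(a, b) ∧ a ∈ U ∧ b ∉ U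

theorem inc_mk {V : Type} (a b : V) : inc s(a, b) = Pi.single a 1 + Pi.single b 1 := rfl

theorem two_eq_zero_pi {V : Type} : (2 : V → ZMod 2) = 0 := funext fun _ => rfl

theorem add_self_pi {V : Type} (f : V → ZMod 2) : f + f = 0 :=
  funext fun _ => CharTwo.add_self_eq_zero _

section Boundary

variable {V ε : Type} {ends : ε → Sym2 V}

theorem bd_empty : bd ends ∅ = 0 := rfl

theorem bd_singleton (e : ε) : bd ends {e} = inc (ends e) := Finset.sum_singleton _ _

theorem bd_union {Z Y : Finset ε} (h : Disjoint Z Y) : bd ends (Z ∪ Y) = bd ends Z + bd ends Y :=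
  Finset.sum_union h

theorem bd_sdiff {Z Y : Finset ε} (h : Y ⊆ Z) : bd ends (Z \ Y) = bd ends Z + bd ends Y := by
  have h1 : bd ends (Z \ Y) + bd ends Y = bd ends Z := Finset.sum_sdiff h
  rw [← h1, add_assoc, add_self_pi, add_zero]

theorem bd_insert {Z : Finset ε} {e : ε} (h : e ∉ Z) :
    bd ends (insert e Z) = inc (ends e) + bd ends Z := Finset.sum_insert h

theorem bd_erase {Z : Finset ε} {e : ε} (h : e ∈ Z) :
    bd ends (Z.erase e) = inc (ends e) + bd ends Z := by
  rw [← bd_singleton, Finset.erase_eq, bd_sdiff (Finset.singleton_subset_iff.2 h), add_comm]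

theorem bd_symmDiff (Z Y : Finset ε) : bd ends (symmDiff Z Y) = bd ends Z + bd ends Y := by
  have h1 : bd ends (Z \ Y) + bd ends (Z ∩ Y) = bd ends Z := by
    rw [← bd_union (Finset.disjoint_sdiff_inter Z Y), Finset.sdiff_union_inter]
  have h2 : bd ends (Y \ Z) + bd ends (Z ∩ Y) = bd ends Y := by
    rw [Finset.inter_comm, ← bd_union (Finset.disjoint_sdiff_inter Y Z),
      Finset.sdiff_union_inter]
  have h3 : symmDiff Z Y = (Z \ Y) ∪ (Y \ Z) := rfl
  have h4 : Disjoint (Z \ Y) (Y \ Z) := disjoint_sdiff_sdiff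
  rw [h3, bd_union h4, ← h1, ← h2]
  have := add_self_pi (bd ends (Z ∩ Y))
  calc _ = bd ends (Z \ Y) + bd ends (Y \ Z) + (bd ends (Z ∩ Y) + bd ends (Z ∩ Y)) := by
        rw [this, add_zero]
    _ = _ := by ring

theorem crosses_mk {U : Set V} {a b : V} : Crosses s(a, b) U ↔ ¬ (a ∈ U ↔ b ∈ U) := by
  constructor
  · rintro ⟨c, d, h, hc, hd⟩
    rcases Sym2.eq_iff.1 h with ⟨rfl, rfl⟩ | ⟨rfl, rfl⟩ <;> tauto
  · intro h
    by_cases ha : a ∈ U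
    · exact ⟨a, b, rfl, ha, by tauto⟩
    · exact ⟨b, a, Sym2.eq_swap, by tauto, ha⟩

theorem sum_inc [Fintype V] (z : Sym2 V) (U : Set V) :
    ∑ v with v ∈ U, inc z v = if Crosses z U then 1 else 0 := by
  induction z with
  | _ a b =>
  have h : ∀ c : V, (∑ v with v ∈ U, (Pi.single c 1 : V → ZMod 2) v) = if c ∈ U then 1 else 0 := by
    intro c
    simp [Pi.single_apply]
  simp only [inc_mk, Pi.add_apply, Finset.sum_add_distrib, h, crosses_mk]
  by_cases ha : a ∈ U <;> by_cases hb : b ∈ U <;> simp [ha, hb, CharTwo.add_self_eq_zero]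

theorem sum_bd [Fintype V] (Z : Finset ε) (U : Set V) :
    ∑ v with v ∈ U, bd ends Z v = ((Z.filter fun e => Crosses (ends e) U).card : ZMod 2) := by
  simp only [bd, Finset.sum_apply]
  rw [Finset.sum_comm]
  simp only [sum_inc]
  rw [Finset.sum_ite, Finset.sum_const_zero, add_zero, Finset.sum_const, nsmul_eq_mul, mul_one]

theorem even_card_crosses [Fintype V] {Z : Finset ε} (h : bd ends Z = 0) (U : Set V) :
    Even (Z.filter fun e => Crosses (ends e) U).card := by
  rw [← ZMod.natCast_eq_zero_iff_even, ← sum_bd, h]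
  simp

/-- The vertices joined to `p` by a set of edges contained in `Y`. -/
def reach (ends : ε → Sym2 V) (Y : Finset ε) (p : V) : Set V :=
  {v | ∃ X ⊆ Y, bd ends X = Pi.single p 1 + Pi.single v 1}

theorem self_mem_reach (Y : Finset ε) (p : V) : p ∈ reach ends Y p :=
  ⟨∅, Finset.empty_subset _, by rw [bd_empty, add_self_pi]⟩

theorem reach_step {Y : Finset ε} {p u v : V} {f : ε} (hf : f ∈ Y) (hfe : ends f = s(u, v))
    (hu : u ∈ reach ends Y p) : v ∈ reach ends Y p := by
  obtain ⟨X, hX, hbd⟩ := hu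
  refine ⟨symmDiff X {f}, ?_, ?_⟩
  · intro e he
    rcases Finset.mem_symmDiff.1 he with h | h
    · exact hX h.1
    · exact (Finset.mem_singleton.1 h.1) ▸ hf
  · rw [bd_symmDiff, hbd, bd_singleton, hfe, inc_mk]
    have := add_self_pi (Pi.single u 1 : V → ZMod 2)
    calc _ = (Pi.single p 1 + Pi.single v 1 : V → ZMod 2)
          + (Pi.single u 1 + Pi.single u 1) := by ring
      _ = _ := by rw [this, add_zero]

theorem not_crosses_reach {Y : Finset ε} {p : V} {f : ε} (hf : f ∈ Y) :
    ¬ Crosses (ends f) (reach ends Y p) := by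
  rintro ⟨a, b, h, ha, hb⟩
  exact hb (reach_step hf h ha)

theorem IsCycle.bd_eq_zero {C : Finset ε} (h : IsCycle ends C) : bd ends C = 0 := by
  obtain ⟨n, v, e, hv, he, hve, rfl⟩ := h
  rw [bd, Finset.sum_image fun i _ j _ hij => he hij]
  simp only [hve, inc_mk, Finset.sum_add_distrib]
  have h : ∑ i, (Pi.single (v (i + 1)) 1 : V → ZMod 2) = ∑ i, Pi.single (v i) 1 :=
    Equiv.sum_comp (Equiv.addRight (1 : Fin (n + 1)))
      fun i => (Pi.single (v i) 1 : V → ZMod 2)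
  rw [h, add_self_pi]

theorem exists_isCycle_subset [Fintype V] {Z : Finset ε} (hZ : bd ends Z = 0)
    (hne : Z.Nonempty) : ∃ C ⊆ Z, C.Nonempty ∧ IsCycle ends C := by
  obtain ⟨e, he⟩ := hne
  obtain ⟨u, v, huv⟩ : ∃ u v, ends e = s(u, v) := by
    induction ends e with
    | _ a b => exact ⟨a, b, rfl⟩
  let G : SimpleGraph V := SimpleGraph.fromRel fun a b => ∃ f ∈ Z.erase e, ends f = s(a, b)
  have hG : ∀ a b, G.Adj a b → ∃ f ∈ Z.erase e, ends f = s(a, b) := by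
    intro a b h
    rcases (SimpleGraph.fromRel_adj _ _ _).1 h with ⟨-, h | ⟨f, hf, h⟩⟩
    · exact h
    · exact ⟨f, hf, by rw [h, Sym2.eq_swap]⟩
  have hr : G.Reachable u v := by
    by_contra hcon
    have hev := even_card_crosses hZ {a | G.Reachable u a}
    have h1 : (Z.filter fun f => Crosses (ends f) {a | G.Reachable u a}) = {e} := by
      ext f
      simp only [Finset.mem_filter, Finset.mem_singleton]
      constructor
      · rintro ⟨hf, a, b, hab, ha, hb⟩
        by_contra hfe
        refine hb (SimpleGraph.Reachable.trans ha ?_)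
        refine SimpleGraph.Adj.reachable ((SimpleGraph.fromRel_adj _ _ _).2 ⟨?_, Or.inl
          ⟨f, Finset.mem_erase.2 ⟨hfe, hf⟩, hab⟩⟩)
        rintro rfl
        exact hb ha
      · rintro rfl
        exact ⟨he, u, v, huv, SimpleGraph.Reachable.refl _, hcon⟩
    rw [h1, Finset.card_singleton] at hev
    exact absurd hev (by decide)
  obtain ⟨p, hp⟩ := hr.exists_isPath
  have hadj : ∀ i, i < p.length → ∃ f ∈ Z.erase e, ends f = s(p.getVert i, p.getVert (i + 1)) :=
    fun i hi => hG _ _ (p.adj_getVert_succ hi)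
  have : Nonempty ε := ⟨e⟩
  choose! g hg hge using hadj
  have hinj : ∀ i j, i ≤ p.length → j ≤ p.length → p.getVert i = p.getVert j → i = j :=
    fun i j hi hj h => hp.getVert_injOn hi hj h
  let E : Fin (p.length + 1) → ε := fun i => if (i : ℕ) < p.length then g i else e
  have hEZ : ∀ i, E i ∈ Z := by
    intro i
    by_cases hi : (i : ℕ) < p.length
    · simp only [E, if_pos hi]; exact Finset.mem_of_mem_erase (hg _ hi)
    · simp only [E, if_neg hi]; exact he
  refine ⟨Finset.univ.image E, ?_, ⟨E 0, Finset.mem_image_of_mem _ (Finset.mem_univ _)⟩,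
    p.length, fun i => p.getVert i, E, ?_, ?_, ?_, rfl⟩
  · intro f hf
    obtain ⟨i, -, rfl⟩ := Finset.mem_image.1 hf
    exact hEZ i
  · intro i j hij
    exact Fin.ext (hinj i j (Nat.lt_succ_iff.1 i.2) (Nat.lt_succ_iff.1 j.2) hij)
  · intro i j hij
    by_cases hi : (i : ℕ) < p.length <;> by_cases hj : (j : ℕ) < p.length
    · simp only [E, if_pos hi, if_pos hj] at hij
      have h := hge i hi
      rw [hij, hge j hj] at h
      apply Fin.ext
      rcases Sym2.eq_iff.1 h with ⟨h1, -⟩ | ⟨h1, h2⟩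
      · exact (hinj _ _ hj.le hi.le h1).symm
      · have := hinj _ _ hj.le hi h1
        have := hinj _ _ hj hi.le h2
        omega
    · simp only [E, if_pos hi, if_neg hj] at hij
      exact absurd (hij ▸ hg i hi) (Finset.notMem_erase _ _)
    · simp only [E, if_neg hi, if_pos hj] at hij
      exact absurd (hij ▸ hg j hj) (Finset.notMem_erase _ _)
    · exact Fin.ext (by omega)
  · intro i
    by_cases hi : (i : ℕ) < p.length
    · have h1 : ((i + 1 : Fin (p.length + 1)) : ℕ) = i + 1 := by
        rw [Fin.val_add_one, if_neg]
        exact fun h => by rw [h] at hi; simp at hi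
      simp only [E, if_pos hi, h1]
      exact hge i hi
    · have h1 : i = Fin.last _ := Fin.ext (by simp; omega)
      subst h1
      simp only [E, if_neg hi, Fin.last_add_one, Fin.val_zero, Fin.val_last,
        SimpleGraph.Walk.getVert_zero, SimpleGraph.Walk.getVert_length]
      rw [huv, Sym2.eq_swap]

theorem sum_nonneg_of_isCycle [Fintype V] {R : Type} [AddCommGroup R] [PartialOrder R]
    [IsOrderedAddMonoid R] {w : ε → R} (hw : ∀ C, IsCycle ends C → 0 ≤ ∑ e ∈ C, w e) (n : ℕ) :
    ∀ Z : Finset ε, Z.card = n → bd ends Z = 0 → 0 ≤ ∑ e ∈ Z, w e := by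
  induction n using Nat.strong_induction_on with
  | _ n ih =>
  intro Z hn hZ
  rcases Z.eq_empty_or_nonempty with rfl | hne
  · simp
  obtain ⟨C, hCZ, hC, hcyc⟩ := exists_isCycle_subset hZ hne
  rw [← Finset.sum_sdiff hCZ]
  refine add_nonneg (ih (Z \ C).card ?_ _ rfl ?_) (hw C hcyc)
  · rw [Finset.card_sdiff_of_subset hCZ, hn]
    have := Finset.card_le_card hCZ
    have := hC.card_pos
    omega
  · rw [bd_sdiff hCZ, hZ, hcyc.bd_eq_zero, add_zero]

end Boundary

section Extremal

variable {V ε : Type} {ends : ε → Sym2 V}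

theorem exists_other_end {z : Sym2 V} {b : V} (h : inc z b = 1) :
    ∃ v, v ≠ b ∧ z = s(b, v) := by
  induction z with
  | _ x y =>
  by_cases hx : x = b <;> by_cases hy : y = b
  · subst hx; subst hy
    rw [inc_mk, add_self_pi] at h
    exact absurd h (by simp)
  · exact ⟨y, hy, by rw [hx]⟩
  · exact ⟨x, hx, by rw [hy, Sym2.eq_swap]⟩
  · exfalso
    rw [inc_mk, Pi.add_apply, Pi.single_eq_of_ne (Ne.symm hx), Pi.single_eq_of_ne (Ne.symm hy)] at h
    exact absurd h (by simp)

theorem inc_apply_of_ne {b v : V} (h : v ≠ b) : inc s(b, v) b = 1 := by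
  rw [inc_mk, Pi.add_apply, Pi.single_eq_same, Pi.single_eq_of_ne h.symm, add_zero]

theorem inc_apply_ne_one {z : Sym2 V} {b : V} (h : inc z b ≠ 1) : inc z b = 0 := by
  generalize inc z b = t at h
  revert h
  revert t
  decide

theorem bd_apply_eq_zero {Y : Finset ε} {b : V} (h : ∀ f ∈ Y, inc (ends f) b = 0) :
    bd ends Y b = 0 := by
  rw [bd, Finset.sum_apply]
  exact Finset.sum_eq_zero h

theorem not_mem_reach {Y : Finset ε} {b p : V} (h : ∀ f ∈ Y, inc (ends f) b = 0) (hp : p ≠ b) :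
    b ∉ reach ends Y p := by
  rintro ⟨X, hX, hbd⟩
  have h1 := bd_apply_eq_zero (ends := ends) (Y := X) fun f hf => h f (hX hf)
  rw [hbd, Pi.add_apply, Pi.single_eq_same, Pi.single_eq_of_ne hp.symm] at h1
  exact absurd h1 (by decide)

/-- A walk that leaves `b` along the edge `f` returns to `b` along a further edge. -/
theorem exists_second_edge [Fintype V] {Z : Finset ε} {b v : V} {f : ε}
    (hZ : Even (Z.filter fun e => Crosses (ends e)
      (reach ends (Z.filter fun e => inc (ends e) b = 0) v)).card)
    (hf : f ∈ Z) (hfe : ends f = s(b, v)) (hv : v ≠ b) :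
    ∃ g ∈ Z, g ≠ f ∧ ∃ u, u ≠ b ∧ ends g = s(b, u) ∧
      ∃ X ⊆ Z.filter (fun e => inc (ends e) b = 0), bd ends X = Pi.single v 1 + Pi.single u 1 := by
  set Y := Z.filter fun e => inc (ends e) b = 0 with hY
  have hb : b ∉ reach ends Y v := not_mem_reach (fun f hf => (Finset.mem_filter.1 hf).2) hv
  have hmem : f ∈ Z.filter fun e => Crosses (ends e) (reach ends Y v) :=
    Finset.mem_filter.2 ⟨hf, v, b, by rw [hfe, Sym2.eq_swap], self_mem_reach Y v, hb⟩
  obtain ⟨g, hg, hgf⟩ : ∃ g ∈ Z.filter fun e => Crosses (ends e) (reach ends Y v), g ≠ f := by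
    by_contra! h
    rw [Finset.eq_singleton_iff_unique_mem.2 ⟨hmem, h⟩, Finset.card_singleton] at hZ
    exact absurd hZ (by decide)
  obtain ⟨hgZ, hgc⟩ := Finset.mem_filter.1 hg
  have hgb : inc (ends g) b = 1 := by
    by_contra h
    exact not_crosses_reach (Finset.mem_filter.2 ⟨hgZ, inc_apply_ne_one h⟩) hgc
  obtain ⟨u, hu, hge⟩ := exists_other_end hgb
  rw [hge, crosses_mk] at hgc
  exact ⟨g, hgZ, hgf, u, hu, hge, by tauto⟩

/-- A set with boundary `{a, b}` which has no nonempty even subset has a single edge at `b`. -/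
theorem existsUnique_edge_at [Fintype V] {J : Finset ε} {a b : V} (hab : a ≠ b)
    (hJ : bd ends J = Pi.single a 1 + Pi.single b 1)
    (hno : ∀ C ⊆ J, bd ends C = 0 → C = ∅) :
    ∃ e ∈ J, inc (ends e) b = 1 ∧ ∀ f ∈ J, inc (ends f) b = 1 → f = e := by
  obtain ⟨e, he, heb⟩ : ∃ e ∈ J, inc (ends e) b = 1 := by
    by_contra! h
    have h1 := bd_apply_eq_zero (ends := ends) (Y := J) fun f hf => inc_apply_ne_one (h f hf)
    rw [hJ, Pi.add_apply, Pi.single_eq_same, Pi.single_eq_of_ne hab.symm] at h1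
    exact absurd h1 (by decide)
  refine ⟨e, he, heb, fun f hf hfb => ?_⟩
  set Y := J.filter fun e => inc (ends e) b = 0 with hY
  have hYb : ∀ g ∈ J, ∀ u, u ≠ b → ends g = s(b, u) → g ∉ Y := by
    intro g _ u hu hge hgY
    have := (Finset.mem_filter.1 hgY).2
    rw [hge, inc_apply_of_ne hu] at this
    exact absurd this (by decide)
  have hpair : ∀ g ∈ J, ∀ g' ∈ J, g' ≠ g → ∀ u u', u ≠ b → u' ≠ b → ends g = s(b, u) →
      ends g' = s(b, u') → ∀ X ⊆ Y, bd ends X = Pi.single u 1 + Pi.single u' 1 → False := by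
    intro g hg g' hg' hne u u' hu hu' hge hge' X hX hbd
    have h1 : g' ∉ X := fun h => hYb g' hg' u' hu' hge' (hX h)
    have h2 : g ∉ insert g' X := by
      rw [Finset.mem_insert, not_or]
      exact ⟨hne.symm, fun h => hYb g hg u hu hge (hX h)⟩
    have h3 := hno (insert g (insert g' X)) (Finset.insert_subset hg (Finset.insert_subset hg'
      (hX.trans (Finset.filter_subset _ _)))) (by
        rw [bd_insert h2, bd_insert h1, hbd, hge, hge', inc_mk, inc_mk]
        linear_combination (Pi.single b 1 + Pi.single u 1 + Pi.single u' 1) *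
          (two_eq_zero_pi (V := V)))
    exact Finset.insert_ne_empty _ _ h3
  have hmem : ∀ g ∈ J, ∀ u, u ≠ b → ends g = s(b, u) → a ∈ reach ends Y u := by
    intro g hg u hu hge
    by_contra hcon
    obtain ⟨g', hg', hne, u', hu', hge', X, hX, hbd⟩ := exists_second_edge (Z := J) (by
      have hbU : b ∉ reach ends Y u := not_mem_reach (fun f hf => (Finset.mem_filter.1 hf).2) hu
      rw [← ZMod.natCast_eq_zero_iff_even, ← sum_bd, hJ]
      simp only [Pi.add_apply, Finset.sum_add_distrib]
      simp [Pi.single_apply, ← hY, hcon, hbU]) hg hge hu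
    exact hpair g hg g' hg' hne u u' hu hu' hge hge' X hX hbd
  by_contra hne
  obtain ⟨u, hu, hfu⟩ := exists_other_end hfb
  obtain ⟨v, hv, hev⟩ := exists_other_end heb
  obtain ⟨X1, hX1, hbd1⟩ := hmem f hf u hu hfu
  obtain ⟨X2, hX2, hbd2⟩ := hmem e he v hv hev
  refine hpair e he f hf hne v u hv hu hev hfu (symmDiff X2 X1) ?_ ?_
  · intro x hx
    rcases Finset.mem_symmDiff.1 hx with h | h
    · exact hX2 h.1
    · exact hX1 h.1
  · rw [bd_symmDiff, hbd1, hbd2]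
    linear_combination (Pi.single a 1) * (two_eq_zero_pi (V := V))

/-- Among the subsets of `R` with boundary of the form `{a, b}`, one of least weight, and among
these one of least cardinality. -/
theorem exists_extremal {R : Finset ε} (w : ε → ℤ) (hR : R.Nonempty) :
    ∃ J ⊆ R, ∃ a b : V, bd ends J = Pi.single a 1 + Pi.single b 1 ∧
      ∀ X ⊆ R, ∀ c d : V, bd ends X = Pi.single c 1 + Pi.single d 1 →
        ∑ e ∈ J, w e ≤ ∑ e ∈ X, w e ∧ (∑ e ∈ X, w e ≤ ∑ e ∈ J, w e → J.card ≤ X.card) := by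
  set S := R.powerset.filter fun J => ∃ a b : V, bd ends J = Pi.single a 1 + Pi.single b 1 with hS
  have hSmem : ∀ X, X ∈ S ↔ X ⊆ R ∧ ∃ a b : V, bd ends X = Pi.single a 1 + Pi.single b 1 := by
    intro X; rw [hS, Finset.mem_filter, Finset.mem_powerset]
  obtain ⟨e, he⟩ := hR
  have hSne : S.Nonempty := by
    refine ⟨{e}, (hSmem _).2 ⟨Finset.singleton_subset_iff.2 he, ?_⟩⟩
    rw [bd_singleton]
    induction ends e with
    | _ x y => exact ⟨x, y, rfl⟩
  obtain ⟨K, hK, hKmin⟩ := S.exists_min_image (fun X => ∑ e ∈ X, w e) hSne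
  obtain ⟨J, hJ, hJmin⟩ := (S.filter fun X => ∑ e ∈ X, w e ≤ ∑ e ∈ K, w e).exists_min_image
    Finset.card ⟨K, Finset.mem_filter.2 ⟨hK, le_rfl⟩⟩
  obtain ⟨hJS, hJK⟩ := Finset.mem_filter.1 hJ
  obtain ⟨hJR, a, b, hab⟩ := (hSmem J).1 hJS
  refine ⟨J, hJR, a, b, hab, fun X hX c d hcd => ?_⟩
  have hXS : X ∈ S := (hSmem X).2 ⟨hX, c, d, hcd⟩
  exact ⟨hJK.trans (hKmin X hXS), fun h => hJmin X (Finset.mem_filter.2 ⟨hXS, h.trans hJK⟩)⟩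

end Extremal

section Star

variable {V ε : Type} {ends : ε → Sym2 V}

/-- The weight `w` moved towards zero by one on the edges leaving the vertex `b`. -/
def shrinkAt (ends : ε → Sym2 V) (w : ε → ℤ) (b : V) (e : ε) : ℤ :=
  w e - if inc (ends e) b = 1 then (w e).sign else 0

/-- Edges of a minimal even set are connected: any vertex it touches is reached from `b`. -/
theorem mem_reach_of_minimal {Z : Finset ε} {b v v₁ x : V} {f g : ε}
    (hZ : bd ends Z = 0) (hmin : ∀ C ⊆ Z, bd ends C = 0 → C.Nonempty → C = Z)
    (hf : f ∈ Z) (hfe : ends f = s(b, v₁)) (hg : g ∈ Z) (hge : ends g = s(v, x)) :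
    v ∈ reach ends Z b := by
  set A := reach ends Z b with hA
  set C := Z.filter fun e => ∃ u ∈ A, ∃ y, ends e = s(u, y) with hC
  have hboth : ∀ e ∈ Z, ∀ u y, ends e = s(u, y) → u ∈ A → y ∈ A :=
    fun e he u y h hu => reach_step he h hu
  have hbd : bd ends C = 0 := by
    funext u
    by_cases hu : u ∈ A
    · have h1 : bd ends C u = bd ends Z u := by
        rw [bd, bd, Finset.sum_apply, Finset.sum_apply]
        refine Finset.sum_subset (Finset.filter_subset _ _) fun e he heC => ?_
        by_contra h
        have h2 : inc (ends e) u = 1 := by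
          by_contra h'; exact h (inc_apply_ne_one h')
        obtain ⟨y, -, hy⟩ := exists_other_end h2
        exact heC (Finset.mem_filter.2 ⟨he, u, hu, y, hy⟩)
      rw [h1, hZ]
    · refine bd_apply_eq_zero fun e he => ?_
      obtain ⟨heZ, z, hz, y, hzy⟩ := Finset.mem_filter.1 he
      have hy := hboth e heZ z y hzy hz
      rw [hzy, inc_mk, Pi.add_apply, Pi.single_eq_of_ne, Pi.single_eq_of_ne, add_zero]
      · rintro rfl; exact hu hy
      · rintro rfl; exact hu hz
  have hCZ := hmin C (Finset.filter_subset _ _) hbd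
    ⟨f, Finset.mem_filter.2 ⟨hf, b, self_mem_reach _ _, v₁, hfe⟩⟩
  have hgC : g ∈ C := hCZ ▸ hg
  obtain ⟨-, u, hu, y, huy⟩ := Finset.mem_filter.1 hgC
  rw [hge] at huy
  rcases Sym2.eq_iff.1 huy with ⟨rfl, -⟩ | ⟨rfl, rfl⟩
  · exact hu
  · exact hboth g hg _ _ (hge.trans Sym2.eq_swap) hu

/-- Exchanging along a minimal even set of weight zero contradicts extremality. -/
theorem exchange_contradiction [Fintype V] {R J Z : Finset ε} {w : ε → ℤ} {a b v₀ v₁ : V}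
    {e₀ f₁ : ε}
    (hnn : ∀ Z ⊆ R, bd ends Z = 0 → 0 ≤ ∑ e ∈ Z, w e)
    (hJR : J ⊆ R) (hJ : bd ends J = Pi.single a 1 + Pi.single b 1)
    (hmin : ∀ X ⊆ R, ∀ c d : V, bd ends X = Pi.single c 1 + Pi.single d 1 →
        ∑ e ∈ J, w e ≤ ∑ e ∈ X, w e ∧ (∑ e ∈ X, w e ≤ ∑ e ∈ J, w e → J.card ≤ X.card))
    (he₀ : e₀ ∈ J) (he₀v : ends e₀ = s(b, v₀)) (hv₀ : v₀ ≠ b)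
    (huniq : ∀ f ∈ J, inc (ends f) b = 1 → f = e₀)
    (hZR : Z ⊆ R) (hZ : bd ends Z = 0) (hZmin : ∀ C ⊆ Z, bd ends C = 0 → C.Nonempty → C = Z)
    (hwZ : ∑ e ∈ Z, w e = 0) (he₀Z : e₀ ∉ Z)
    (hf₁ : f₁ ∈ Z) (hf₁v : ends f₁ = s(b, v₁)) (hwf₁ : 0 < w f₁) : False := by
  have h2 := two_eq_zero_pi (V := V)
  set Y := (J \ Z).erase e₀ with hY
  have hYJ : Y ⊆ J := (Finset.erase_subset _ _).trans Finset.sdiff_subset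
  have hYb : ∀ f ∈ Y, inc (ends f) b = 0 := fun f hf => inc_apply_ne_one fun h =>
    (Finset.ne_of_mem_erase hf) (huniq f (hYJ hf) h)
  set B := reach ends Y v₀ with hB
  have hbB : b ∉ B := not_mem_reach hYb hv₀
  have hQ : ∀ v ∈ B, ∃ Q ⊆ J, Disjoint Q Z ∧ e₀ ∈ Q ∧
      bd ends Q = Pi.single b 1 + Pi.single v 1 := by
    rintro v ⟨X, hX, hbd⟩
    refine ⟨insert e₀ X, Finset.insert_subset he₀ (hX.trans hYJ), ?_,
      Finset.mem_insert_self _ _, ?_⟩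
    · rw [Finset.disjoint_insert_left]
      refine ⟨he₀Z, Finset.disjoint_left.2 fun e he => ?_⟩
      exact (Finset.mem_sdiff.1 (Finset.mem_of_mem_erase (hX he))).2
    · rw [bd_insert fun h => Finset.notMem_erase _ _ (hX h), hbd, he₀v, inc_mk]
      linear_combination (Pi.single v₀ 1) * h2
  have hsd : ∀ {S T : Finset ε}, T ⊆ S → ∑ e ∈ S \ T, w e = ∑ e ∈ S, w e - ∑ e ∈ T, w e :=
    fun h => by rw [← Finset.sum_sdiff h]; ring
  by_cases hT : ∃ v ∈ B, ∃ g ∈ Z, ∃ x, ends g = s(v, x)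
  · obtain ⟨v, hv, g, hg, x, hgx⟩ := hT
    obtain ⟨Q, hQJ, hQZ, heQ, hbdQ⟩ := hQ v hv
    obtain ⟨C, hC, hbdC⟩ := mem_reach_of_minimal hZ hZmin hf₁ hf₁v hg hgx
    have hd1 : Disjoint C Q := (hQZ.mono_right hC).symm
    have hd2 : Disjoint (Z \ C) Q := (hQZ.mono_right Finset.sdiff_subset).symm
    have h3 := hnn (C ∪ Q) (Finset.union_subset (hC.trans hZR) (hQJ.trans hJR)) (by
      rw [bd_union hd1, hbdC, hbdQ, add_self_pi])
    have h4 := hnn ((Z \ C) ∪ Q) (Finset.union_subset (Finset.sdiff_subset.trans hZR)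
      (hQJ.trans hJR)) (by
        rw [bd_union hd2, bd_sdiff hC, hZ, hbdC, hbdQ, zero_add, add_self_pi])
    rw [Finset.sum_union hd1] at h3
    rw [Finset.sum_union hd2, hsd hC, hwZ] at h4
    obtain ⟨h5, h6⟩ := hmin (J \ Q) (Finset.sdiff_subset.trans hJR) a v (by
      rw [bd_sdiff hQJ, hJ, hbdQ]
      linear_combination (Pi.single b 1) * h2)
    rw [hsd hQJ] at h5 h6
    have h7 := h6 (by linarith)
    rw [Finset.card_sdiff_of_subset hQJ] at h7
    have h8 := Finset.card_le_card hQJ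
    have h9 : 0 < Q.card := Finset.card_pos.2 ⟨e₀, heQ⟩
    omega
  · have haB : a ∈ B := by
      by_contra haB
      have h3 : (J.filter fun e => Crosses (ends e) B) = {e₀} := by
        refine Finset.eq_singleton_iff_unique_mem.2 ⟨Finset.mem_filter.2 ⟨he₀, v₀, b,
          by rw [he₀v, Sym2.eq_swap], self_mem_reach _ _, hbB⟩, fun f hf => ?_⟩
        obtain ⟨hfJ, hfc⟩ := Finset.mem_filter.1 hf
        by_contra hne
        by_cases hfZ : f ∈ Z
        · obtain ⟨u, y, h, hu, -⟩ := hfc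
          exact hT ⟨u, hu, f, hfZ, y, h⟩
        · exact not_crosses_reach (Finset.mem_erase.2 ⟨hne, Finset.mem_sdiff.2 ⟨hfJ, hfZ⟩⟩) hfc
      have h4 := sum_bd (ends := ends) J B
      rw [h3, hJ] at h4
      simp only [Pi.add_apply, Finset.sum_add_distrib] at h4
      simp [Pi.single_apply, haB, hbB] at h4
    obtain ⟨Q, hQJ, hQZ, heQ, hbdQ⟩ := hQ a haB
    have h3 := hnn (J \ Q) (Finset.sdiff_subset.trans hJR) (by
      rw [bd_sdiff hQJ, hJ, hbdQ]
      linear_combination (Pi.single a 1 + Pi.single b 1) * h2)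
    rw [hsd hQJ] at h3
    have hmem : f₁ ∈ Q ∪ Z := Finset.mem_union_right _ hf₁
    obtain ⟨h5, -⟩ := hmin ((Q ∪ Z).erase f₁) ((Finset.erase_subset _ _).trans
      (Finset.union_subset (hQJ.trans hJR) hZR)) a v₁ (by
        rw [bd_erase hmem, bd_union hQZ, hZ, hbdQ, hf₁v, inc_mk]
        linear_combination (Pi.single b 1) * h2)
    have h6 := Finset.add_sum_erase _ w hmem
    rw [Finset.sum_union hQZ, hwZ] at h6
    linarith

theorem exists_shrinkAt [Fintype V] {R : Finset ε} {w : ε → ℤ} (hw0 : ∀ e ∈ R, w e ≠ 0)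
    (hnn : ∀ Z ⊆ R, bd ends Z = 0 → 0 ≤ ∑ e ∈ Z, w e)
    (hev : ∀ Z ⊆ R, bd ends Z = 0 → Even (∑ e ∈ Z, w e)) (hneg : ∃ e ∈ R, w e < 0) :
    ∃ b : V, ∃ e₀ ∈ R, w e₀ < 0 ∧ inc (ends e₀) b = 1 ∧
      (∀ f ∈ R, w f < 0 → inc (ends f) b = 1 → f = e₀) ∧
      ∀ Z ⊆ R, bd ends Z = 0 → 0 ≤ ∑ e ∈ Z, shrinkAt ends w b e := by
  have h2 := two_eq_zero_pi (V := V)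
  obtain ⟨e, heR, hwe⟩ := hneg
  obtain ⟨J, hJR, a, b, hJ, hmin⟩ := exists_extremal (ends := ends) w ⟨e, heR⟩
  have hwJ : ∑ e ∈ J, w e < 0 := by
    obtain ⟨x, y, hxy⟩ : ∃ x y, ends e = s(x, y) := by
      induction ends e with
      | _ x y => exact ⟨x, y, rfl⟩
    have := (hmin {e} (Finset.singleton_subset_iff.2 heR) x y (by rw [bd_singleton, hxy, inc_mk])).1
    rw [Finset.sum_singleton] at this
    linarith
  have hab : a ≠ b := by
    rintro rfl
    have := hnn J hJR (by rw [hJ, add_self_pi])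
    linarith
  have hno : ∀ C ⊆ J, bd ends C = 0 → C = ∅ := by
    intro C hC hbd
    have h3 := (hmin (J \ C) (Finset.sdiff_subset.trans hJR) a b (by
      rw [bd_sdiff hC, hJ, hbd, add_zero])).2 (by
        have := Finset.sum_sdiff (f := w) hC
        have := hnn C (hC.trans hJR) hbd
        linarith)
    rw [Finset.card_sdiff_of_subset hC] at h3
    have := Finset.card_le_card hC
    exact Finset.card_eq_zero.1 (by
      by_contra h
      omega)
  obtain ⟨e₀, he₀, he₀b, huniq⟩ := existsUnique_edge_at hab hJ hno
  have hin : ∀ f ∈ J, inc (ends f) b = 1 → w f < 0 := by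
    intro f hf hfb
    obtain ⟨v, -, hv⟩ := exists_other_end hfb
    have h3 := (hmin (J.erase f) ((Finset.erase_subset _ _).trans hJR) a v (by
      rw [bd_erase hf, hJ, hv, inc_mk]
      linear_combination (Pi.single b 1) * h2)).1
    have := Finset.add_sum_erase _ w hf
    exact lt_of_le_of_ne (by linarith) (hw0 f (hJR hf))
  have hout : ∀ f ∈ R, f ∉ J → inc (ends f) b = 1 → 0 < w f := by
    intro f hfR hf hfb
    obtain ⟨v, -, hv⟩ := exists_other_end hfb
    have h3 := (hmin (insert f J) (Finset.insert_subset hfR hJR) a v (by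
      rw [bd_insert hf, hJ, hv, inc_mk]
      linear_combination (Pi.single b 1) * h2)).1
    rw [Finset.sum_insert hf] at h3
    exact lt_of_le_of_ne (by linarith) (hw0 f hfR).symm
  refine ⟨b, e₀, hJR he₀, hin e₀ he₀ he₀b, he₀b, fun f hfR hwf hfb => ?_, ?_⟩
  · by_contra hne
    exact absurd (hout f hfR (fun h => hne (huniq f h hfb)) hfb) (by linarith)
  by_contra! hcon
  obtain ⟨Z₀, hZ₀⟩ := hcon
  obtain ⟨Z, hZ, hZcard⟩ := (R.powerset.filter fun Z => bd ends Z = 0 ∧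
    ∑ e ∈ Z, shrinkAt ends w b e < 0).exists_min_image Finset.card
    ⟨Z₀, Finset.mem_filter.2 ⟨Finset.mem_powerset.2 hZ₀.1, hZ₀.2⟩⟩
  simp only [Finset.mem_filter, Finset.mem_powerset] at hZ hZcard
  obtain ⟨hZR, hZbd, hZneg⟩ := hZ
  have hsmall : ∀ C ⊆ Z, bd ends C = 0 → C ≠ Z → 0 ≤ ∑ e ∈ C, shrinkAt ends w b e := by
    intro C hC hbd hne
    by_contra! h
    exact absurd (hZcard C ⟨hC.trans hZR, hbd, h⟩)
      (not_le.2 (Finset.card_lt_card (hC.ssubset_of_ne hne)))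
  have hZmin : ∀ C ⊆ Z, bd ends C = 0 → C.Nonempty → C = Z := by
    intro C hC hbd hCne
    by_contra hne
    have h3 := hsmall C hC hbd hne
    have h4 := hsmall (Z \ C) Finset.sdiff_subset (by rw [bd_sdiff hC, hZbd, hbd, add_zero]) (by
      intro h
      obtain ⟨x, hx⟩ := hCne
      exact (Finset.mem_sdiff.1 (h ▸ hC hx)).2 hx)
    have := Finset.sum_sdiff (f := shrinkAt ends w b) hC
    linarith
  obtain ⟨f₁, hf₁, hf₁b⟩ : ∃ f ∈ Z, inc (ends f) b = 1 := by
    by_contra! h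
    have h3 := hnn Z hZR hZbd
    rw [Finset.sum_congr rfl fun e he => (by simp [shrinkAt, h e he] :
      w e = shrinkAt ends w b e)] at h3
    linarith
  obtain ⟨v₁, hv₁, hf₁v⟩ := exists_other_end hf₁b
  obtain ⟨f₂, hf₂, hne, v₂, hv₂, hf₂v, X, hX, hXbd⟩ := exists_second_edge
    (even_card_crosses hZbd _) hf₁ hf₁v hv₁
  have hf₂b : inc (ends f₂) b = 1 := by rw [hf₂v, inc_apply_of_ne hv₂]
  have hX0 : ∀ f ∈ X, inc (ends f) b = 0 := fun f hf => (Finset.mem_filter.1 (hX hf)).2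
  have hX1 : ∀ f, inc (ends f) b = 1 → f ∉ X := fun f hf h => by
    rw [hX0 f h] at hf; exact absurd hf (by decide)
  have h3 : f₁ ∉ insert f₂ X := by
    rw [Finset.mem_insert, not_or]; exact ⟨hne.symm, hX1 f₁ hf₁b⟩
  have hZeq : insert f₁ (insert f₂ X) = Z := hZmin _
    (Finset.insert_subset hf₁ (Finset.insert_subset hf₂ (hX.trans (Finset.filter_subset _ _))))
    (by
      rw [bd_insert h3, bd_insert (hX1 f₂ hf₂b), hXbd, hf₁v, hf₂v, inc_mk, inc_mk]
      linear_combination (Pi.single b 1 + Pi.single v₁ 1 + Pi.single v₂ 1) * h2)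
    (Finset.insert_nonempty _ _)
  have hsum : ∑ e ∈ Z, shrinkAt ends w b e
      = ∑ e ∈ Z, w e - (w f₁).sign - (w f₂).sign := by
    rw [← hZeq, Finset.sum_insert h3, Finset.sum_insert (hX1 f₂ hf₂b), Finset.sum_insert h3,
      Finset.sum_insert (hX1 f₂ hf₂b), Finset.sum_congr rfl fun e he => (by
        simp [shrinkAt, hX0 e he] : shrinkAt ends w b e = w e)]
    simp only [shrinkAt, hf₁b, hf₂b, if_true]
    ring
  have hwZ := hnn Z hZR hZbd
  have hpos : ∀ f ∈ R, inc (ends f) b = 1 → f ≠ e₀ → 0 < w f := fun f hf hfb hne =>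
    hout f hf (fun h => hne (huniq f h hfb)) hfb
  have hs₀ : (w e₀).sign = -1 := Int.sign_eq_neg_one_of_neg (hin e₀ he₀ he₀b)
  have hne₁ : f₁ ≠ e₀ := by
    rintro rfl
    rw [hs₀, Int.sign_eq_one_of_pos (hpos f₂ (hZR hf₂) hf₂b hne)] at hsum
    linarith
  have hne₂ : f₂ ≠ e₀ := by
    rintro rfl
    rw [hs₀, Int.sign_eq_one_of_pos (hpos f₁ (hZR hf₁) hf₁b hne.symm)] at hsum
    linarith
  have hp₁ := hpos f₁ (hZR hf₁) hf₁b hne₁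
  rw [Int.sign_eq_one_of_pos hp₁, Int.sign_eq_one_of_pos (hpos f₂ (hZR hf₂) hf₂b hne₂)] at hsum
  have hwZ0 : ∑ e ∈ Z, w e = 0 := by
    obtain ⟨k, hk⟩ := hev Z hZR hZbd
    omega
  have he₀Z : e₀ ∉ Z := by
    rw [← hZeq, Finset.mem_insert, Finset.mem_insert]
    rintro (h | h | h)
    · exact hne₁ h.symm
    · exact hne₂ h.symm
    · exact hX1 e₀ he₀b h
  obtain ⟨v₀, hv₀, he₀v⟩ := exists_other_end he₀b
  exact exchange_contradiction hnn hJR hJ hmin he₀ he₀v hv₀ huniq hZR hZbd hZmin hwZ0 he₀Z hf₁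
    hf₁v hp₁

end Star

section Contraction

variable {V ε : Type} {ends : ε → Sym2 V}

/-- Vertices joined by a walk of edges satisfying `P`. -/
def Linked (ends : ε → Sym2 V) (P : ε → Prop) : V → V → Prop :=
  Relation.ReflTransGen fun x y => ∃ e, P e ∧ ends e = s(x, y)

theorem Linked.symm {P : ε → Prop} {u v : V} (h : Linked ends P u v) : Linked ends P v u := by
  induction h with
  | refl => exact .refl
  | tail _ hyz ih =>
    obtain ⟨e, he, hez⟩ := hyz
    exact Relation.ReflTransGen.head ⟨e, he, hez.trans Sym2.eq_swap⟩ ih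

theorem Linked.mem {P : ε → Prop} {u v : V} (h : Linked ends P u v) {U : Set V}
    (hU : ∀ e, P e → ¬ Crosses (ends e) U) (hu : u ∈ U) : v ∈ U := by
  induction h with
  | refl => exact hu
  | tail _ hyz ih =>
    obtain ⟨e, he, hez⟩ := hyz
    have := hU e he
    rw [hez, crosses_mk] at this
    tauto

/-- The contraction of the edges satisfying `P`. -/
def linkedSetoid (ends : ε → Sym2 V) (P : ε → Prop) : Setoid V :=
  ⟨Linked ends P, fun _ => .refl, fun h => h.symm, fun h h' => Relation.ReflTransGen.trans h h'⟩

theorem inc_map [Fintype V] {W : Type} (π : V → W) (z : Sym2 V) (q : W) :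
    inc (z.map π) q = ∑ v with v ∈ π ⁻¹' {q}, inc z v := by
  induction z with
  | _ a b =>
  simp only [Sym2.map_mk, inc_mk, Pi.add_apply, Finset.sum_add_distrib, Pi.single_apply]
  simp [eq_comm]

theorem inc_map_eq_one [Fintype V] {W : Type} (π : V → W) (z : Sym2 V) (q : W) :
    inc (z.map π) q = 1 ↔ Crosses z (π ⁻¹' {q}) := by
  rw [inc_map, sum_inc]
  by_cases h : Crosses z (π ⁻¹' {q}) <;> simp [h]

theorem bd_map [Fintype V] {W : Type} (π : V → W) (Z : Finset ε) (q : W) :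
    bd (fun e => (ends e).map π) Z q = ∑ v with v ∈ π ⁻¹' {q}, bd ends Z v := by
  simp only [bd, Finset.sum_apply, inc_map]
  rw [Finset.sum_comm]

theorem connectedOn_fiber {P : ε → Prop} (q : Quotient (linkedSetoid ends P)) :
    ConnectedOn ends (Quotient.mk (linkedSetoid ends P) ⁻¹' {q}) := by
  refine ⟨⟨q.out, q.out_eq⟩, ?_⟩
  intro a ha b hb
  have hab : Linked ends P a b := by
    have h1 : Quotient.mk (linkedSetoid ends P) a = q := ha
    have h2 : Quotient.mk (linkedSetoid ends P) b = q := hb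
    exact Quotient.exact (h1.trans h2.symm)
  clear hb
  have key : Relation.ReflTransGen (fun x y => x ∈ Quotient.mk (linkedSetoid ends P) ⁻¹' {q} ∧
      y ∈ Quotient.mk (linkedSetoid ends P) ⁻¹' {q} ∧ ∃ e, ends e = s(x, y)) a b ∧
      b ∈ Quotient.mk (linkedSetoid ends P) ⁻¹' {q} := by
    induction hab with
    | refl => exact ⟨.refl, ha⟩
    | @tail y z _ hyz ih =>
      obtain ⟨e, he, hez⟩ := hyz
      have hz : z ∈ Quotient.mk (linkedSetoid ends P) ⁻¹' {q} := by
        have h1 : Quotient.mk (linkedSetoid ends P) y = q := ih.2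
        have h2 : Quotient.mk (linkedSetoid ends P) y = Quotient.mk (linkedSetoid ends P) z :=
          Quotient.sound (s := linkedSetoid ends P)
            (Relation.ReflTransGen.single ⟨e, he, hez⟩ : Linked ends P y z)
        exact h2.symm.trans h1
      exact ⟨ih.1.tail ⟨ih.2, hz, e, hez⟩, hz⟩
  exact key.1

theorem not_crosses_fiber {P : ε → Prop} (q : Quotient (linkedSetoid ends P)) {e : ε} (he : P e) :
    ¬ Crosses (ends e) (Quotient.mk (linkedSetoid ends P) ⁻¹' {q}) := by
  rintro ⟨a, b, h, ha, hb⟩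
  have h2 : Quotient.mk (linkedSetoid ends P) a = Quotient.mk (linkedSetoid ends P) b :=
    Quotient.sound (s := linkedSetoid ends P)
      (Relation.ReflTransGen.single ⟨e, he, h⟩ : Linked ends P a b)
  exact hb (h2.symm.trans ha)

theorem Linked.mem_reach [Fintype ε] {P : ε → Prop} {u v : V} (h : Linked ends P u v) :
    v ∈ reach ends (Finset.univ.filter P) u := by
  refine h.mem (fun e he => ?_) (self_mem_reach _ _)
  exact not_crosses_reach (Finset.mem_filter.2 ⟨Finset.mem_univ _, he⟩)

/-- A set that is even after contracting the edges satisfying `P` can be completed by such edges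
to an even set. -/
theorem exists_bd_eq [Fintype V] [Fintype ε] {P : ε → Prop} {f : V → ZMod 2}
    (hf : ∀ q, ∑ v with v ∈ Quotient.mk (linkedSetoid ends P) ⁻¹' {q}, f v = 0) :
    ∃ Y : Finset ε, (∀ e ∈ Y, P e) ∧ bd ends Y = f := by
  set π := Quotient.mk (linkedSetoid ends P) with hπ
  have hrep : ∀ v, ∃ Y ⊆ Finset.univ.filter P,
      bd ends Y = Pi.single v 1 + Pi.single (π v).out 1 := by
    intro v
    have h : Linked ends P v (π v).out :=
      (Quotient.exact (s := linkedSetoid ends P) (π v).out_eq).symm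
    exact h.mem_reach
  have hsum : ∀ S : Finset V, ∃ Y ⊆ Finset.univ.filter P,
      bd ends Y = ∑ v ∈ S, (Pi.single v 1 + Pi.single (π v).out 1) := by
    intro S
    induction S using Finset.induction_on with
    | empty => exact ⟨∅, Finset.empty_subset _, by simp [bd_empty]⟩
    | insert v S hv ih =>
      obtain ⟨Y, hY, hYbd⟩ := ih
      obtain ⟨X, hX, hXbd⟩ := hrep v
      refine ⟨symmDiff X Y, fun e he => ?_, ?_⟩
      · rcases Finset.mem_symmDiff.1 he with h | h
        · exact hX h.1
        · exact hY h.1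
      · rw [bd_symmDiff, hXbd, hYbd, Finset.sum_insert hv]
  obtain ⟨Y, hY, hYbd⟩ := hsum (Finset.univ.filter fun v => f v = 1)
  refine ⟨Y, fun e he => (Finset.mem_filter.1 (hY he)).2, ?_⟩
  have hf1 : ∀ v, (if f v = 1 then 1 else 0 : ZMod 2) = f v := by
    intro v
    generalize f v = t
    revert t
    decide
  rw [hYbd, Finset.sum_add_distrib]
  funext u
  have h1 : (∑ v with f v = 1, (Pi.single v 1 : V → ZMod 2)) u = f u := by
    rw [Finset.sum_apply]
    simp only [Pi.single_apply, Finset.sum_ite_eq, Finset.mem_filter, Finset.mem_univ, true_and]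
    exact hf1 u
  have h2 : (∑ v with f v = 1, (Pi.single (π v).out 1 : V → ZMod 2)) u = 0 := by
    rw [Finset.sum_apply, Finset.sum_filter]
    by_cases hu : (π u).out = u
    · refine Eq.trans ?_ (hf (π u))
      rw [Finset.sum_filter]
      refine Finset.sum_congr rfl fun v _ => ?_
      by_cases hv : π v = π u
      · simp only [Set.mem_preimage, Set.mem_singleton_iff, hv, hu, Pi.single_eq_same, if_true]
        exact hf1 v
      · have : (π v).out ≠ u := by
          rintro rfl
          exact hv (by rw [hπ, Quotient.out_eq])
        simp [hv, Pi.single_eq_of_ne this.symm]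
    · refine Finset.sum_eq_zero fun v _ => ?_
      have : (π v).out ≠ u := by
        rintro rfl
        exact hu (by rw [hπ, Quotient.out_eq])
      simp [Pi.single_eq_of_ne this.symm]
  rw [Pi.add_apply, h1, h2, add_zero]

end Contraction

section Packing

variable {V ε : Type} {ends : ε → Sym2 V}

/-- Capacities with a negative sign on the demand edges. -/
def signedCap (Dem : Finset ε) (c : ε → ℕ) (e : ε) : ℤ :=
  if e ∈ Dem then -(c e : ℤ) else c e

theorem even_sum_signedCap (Dem : Finset ε) (c : ε → ℕ) (Z : Finset ε) :
    Even (∑ e ∈ Z, signedCap Dem c e) ↔ Even (∑ e ∈ Z, c e) := by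
  have h : ∑ e ∈ Z, signedCap Dem c e
      = ((∑ e ∈ Z, c e : ℕ) : ℤ) - 2 * ∑ e ∈ Z, if e ∈ Dem then (c e : ℤ) else 0 := by
    push_cast
    rw [Finset.mul_sum, ← Finset.sum_sub_distrib]
    refine Finset.sum_congr rfl fun e _ => ?_
    by_cases he : e ∈ Dem <;> simp only [signedCap, he, if_true, if_false] <;> ring
  rw [h, Int.even_sub, Int.even_coe_nat]
  simp

/-- The capacities that remain after packing the cut of `U`. -/
def remCap (ends : ε → Sym2 V) (c : ε → ℕ) (U : Set V) (e : ε) : ℕ :=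
  c e - if Crosses (ends e) U then 1 else 0

theorem exists_first_cut [Fintype V] [Fintype ε] {Dem : Finset ε} {c : ε → ℕ}
    (hnn : ∀ Z, bd ends Z = 0 → 0 ≤ ∑ e ∈ Z, signedCap Dem c e)
    (hev : ∀ Z, bd ends Z = 0 → Even (∑ e ∈ Z, c e)) (hDem : ∃ e ∈ Dem, c e ≠ 0) :
    ∃ U : Set V, ConnectedOn ends U ∧ (∀ e, c e = 0 → ¬ Crosses (ends e) U) ∧
      (∀ T : Set V, (∀ e, c e = 0 → ¬ Crosses (ends e) T) → U ⊆ T ∨ Disjoint U T) ∧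
      (∃ e ∈ Dem, Crosses (ends e) U ∧ ∀ f ∈ Dem, Crosses (ends f) U → f = e) ∧
      ∀ Z, bd ends Z = 0 → 0 ≤ ∑ e ∈ Z, signedCap Dem (remCap ends c U) e := by
  set P : ε → Prop := fun e => c e = 0 with hP
  set π := Quotient.mk (linkedSetoid ends P) with hπ
  set R := Finset.univ.filter fun e => c e ≠ 0 with hR
  have hw0 : ∀ e, signedCap Dem c e = 0 ↔ c e = 0 := by
    intro e
    by_cases he : e ∈ Dem <;> simp [signedCap, he]
  have htransfer : ∀ Z ⊆ R, bd (fun e => (ends e).map π) Z = 0 →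
      ∃ Z' : Finset ε, bd ends Z' = 0 ∧
        ∑ e ∈ Z', signedCap Dem c e = ∑ e ∈ Z, signedCap Dem c e := by
    intro Z hZR hZ
    obtain ⟨Y, hYc, hYbd⟩ := exists_bd_eq (ends := ends) (P := P) (f := bd ends Z) fun q => by
      rw [← bd_map, hZ, Pi.zero_apply]
    have hd : Disjoint Z Y := Finset.disjoint_left.2 fun e he heY =>
      (Finset.mem_filter.1 (hZR he)).2 (hYc e heY)
    refine ⟨Z ∪ Y, by rw [bd_union hd, hYbd, add_self_pi], ?_⟩
    rw [Finset.sum_union hd, Finset.sum_eq_zero (s := Y) fun e he => (hw0 e).2 (hYc e he),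
      add_zero]
  obtain ⟨b, e₀, he₀R, hwe₀, he₀b, huniq, hshrink⟩ := exists_shrinkAt
    (ends := fun e => (ends e).map π) (R := R) (w := signedCap Dem c)
    (fun e he h => (Finset.mem_filter.1 he).2 ((hw0 e).1 h))
    (fun Z hZR hZ => by
      obtain ⟨Z', hZ', h⟩ := htransfer Z hZR hZ
      exact h ▸ hnn Z' hZ')
    (fun Z hZR hZ => by
      obtain ⟨Z', hZ', h⟩ := htransfer Z hZR hZ
      exact h ▸ (even_sum_signedCap Dem c Z').2 (hev Z' hZ'))
    (by
      obtain ⟨e, he, hce⟩ := hDem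
      refine ⟨e, Finset.mem_filter.2 ⟨Finset.mem_univ _, hce⟩, ?_⟩
      simp only [signedCap, he, if_true]
      omega)
  have hzero : ∀ e, c e = 0 → ¬ Crosses (ends e) (π ⁻¹' {b}) := fun e he =>
    not_crosses_fiber b he
  refine ⟨π ⁻¹' {b}, connectedOn_fiber b, hzero, ?_, ?_, ?_⟩
  · intro T hT
    by_cases h : Disjoint (π ⁻¹' {b}) T
    · exact Or.inr h
    · obtain ⟨v, hv, hvT⟩ := Set.not_disjoint_iff.1 h
      refine Or.inl fun u hu => ?_
      have h1 : π v = b := hv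
      have h2 : π u = b := hu
      have hl : Linked ends P v u := Quotient.exact (h1.trans h2.symm)
      exact hl.mem hT hvT
  · refine ⟨e₀, ?_, (inc_map_eq_one _ _ _).1 he₀b, fun f hf hfc => ?_⟩
    · by_contra h
      simp only [signedCap, h, if_false] at hwe₀
      omega
    · have hcf : c f ≠ 0 := fun h => hzero f h hfc
      refine huniq f (Finset.mem_filter.2 ⟨Finset.mem_univ _, hcf⟩) ?_
        ((inc_map_eq_one _ _ _).2 hfc)
      simp only [signedCap, hf, if_true]
      omega
  · intro Z hZ
    have h1 : bd (fun e => (ends e).map π) (Z.filter fun e => c e ≠ 0) = 0 := by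
      have h2 : bd (fun e => (ends e).map π) (Z.filter fun e => c e ≠ 0)
          = bd (fun e => (ends e).map π) Z := by
        refine Finset.sum_subset (Finset.filter_subset _ _) fun e he hne => ?_
        have hce : c e = 0 := by
          by_contra h
          exact hne (Finset.mem_filter.2 ⟨he, h⟩)
        funext q
        exact inc_apply_ne_one fun h => not_crosses_fiber q hce ((inc_map_eq_one _ _ _).1 h)
      rw [h2]
      funext q
      rw [bd_map, hZ]
      simp
    have h3 := hshrink _ (fun e he => Finset.mem_filter.2 ⟨Finset.mem_univ _,
      (Finset.mem_filter.1 he).2⟩) h1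
    have h4 : ∀ e, signedCap Dem (remCap ends c (π ⁻¹' {b})) e
        = shrinkAt (fun e => (ends e).map π) (signedCap Dem c) b e := by
      intro e
      simp only [shrinkAt, inc_map_eq_one]
      by_cases hc : Crosses (ends e) (π ⁻¹' {b})
      · have hce : c e ≠ 0 := fun h => hzero e h hc
        by_cases he : e ∈ Dem
        · simp only [signedCap, remCap, he, hc, if_true]
          rw [Int.sign_eq_neg_one_of_neg (by omega)]
          omega
        · simp only [signedCap, remCap, he, hc, if_true, if_false]
          rw [Int.sign_eq_one_of_pos (by omega)]
          omega
      · simp [signedCap, remCap, hc]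
    rw [Finset.sum_congr rfl fun e _ => h4 e]
    rw [Finset.sum_filter_of_ne] at h3
    · exact h3
    · intro e _ hne hce
      refine hne ?_
      have := (hw0 e).2 hce
      simp [shrinkAt, this]

/-- A laminar packing of cuts that contain exactly one demand edge and saturate the demands. -/
theorem exists_packing [Fintype V] [Fintype ε] {Dem : Finset ε} (N : ℕ) :
    ∀ c : ε → ℕ, ∑ e, c e = N →
    (∀ Z, bd ends Z = 0 → 0 ≤ ∑ e ∈ Z, signedCap Dem c e) →
    (∀ Z, bd ends Z = 0 → Even (∑ e ∈ Z, c e)) →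
    ∃ (n : ℕ) (U : ℕ → Set V), (∀ i < n, ConnectedOn ends (U i)) ∧
      (∀ i < n, ∃ e ∈ Dem, Crosses (ends e) (U i) ∧
        ∀ f ∈ Dem, Crosses (ends f) (U i) → f = e) ∧
      (∀ i j, i < j → j < n → U i ⊆ U j ∨ Disjoint (U i) (U j)) ∧
      (∀ e, ((Finset.range n).filter fun i => Crosses (ends e) (U i)).card ≤ c e) ∧
      ∀ e ∈ Dem, ((Finset.range n).filter fun i => Crosses (ends e) (U i)).card = c e := by
  induction N using Nat.strong_induction_on with
  | _ N ih =>
  intro c hN hnn hev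
  by_cases hDem : ∃ e ∈ Dem, c e ≠ 0
  swap
  · push Not at hDem
    exact ⟨0, fun _ => ∅, by simp, by simp, by simp, by simp, fun e he => by simp [hDem e he]⟩
  obtain ⟨U₀, hconn, hzero, hlam, ⟨e₀, he₀, he₀U, huniq⟩, hnn'⟩ := exists_first_cut hnn hev hDem
  have hrem : ∀ e, c e = remCap ends c U₀ e + if Crosses (ends e) U₀ then 1 else 0 := by
    intro e
    by_cases h : Crosses (ends e) U₀
    · have : c e ≠ 0 := fun h' => hzero e h' h
      simp only [remCap, h, if_true]
      omega
    · simp [remCap, h]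
  have hlt : ∑ e, remCap ends c U₀ e < N := by
    rw [← hN]
    refine Finset.sum_lt_sum (fun e _ => Nat.sub_le _ _) ⟨e₀, Finset.mem_univ _, ?_⟩
    have := hrem e₀
    rw [if_pos he₀U] at this
    omega
  obtain ⟨n, U, h1, h2, h3, h4, h5⟩ := ih _ hlt (remCap ends c U₀) rfl hnn' (by
    intro Z hZ
    have h6 := hev Z hZ
    rw [Finset.sum_congr rfl fun e _ => hrem e, Finset.sum_add_distrib, ← Finset.card_filter,
      Nat.even_add] at h6
    exact h6.2 (even_card_crosses hZ U₀))
  set U' : ℕ → Set V := fun i => Nat.casesOn i U₀ U with hU'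
  have hcount : ∀ e, ((Finset.range (n + 1)).filter fun i => Crosses (ends e) (U' i)).card
      = ((Finset.range n).filter fun i => Crosses (ends e) (U i)).card
        + if Crosses (ends e) U₀ then 1 else 0 := by
    intro e
    rw [Finset.card_filter, Finset.sum_range_succ', Finset.card_filter]
    rfl
  refine ⟨n + 1, U', ?_, ?_, ?_, ?_, ?_⟩
  · rintro (_ | i) hi
    · exact hconn
    · exact h1 i (by omega)
  · rintro (_ | i) hi
    · exact ⟨e₀, he₀, he₀U, huniq⟩
    · exact h2 i (by omega)
  · rintro i (_ | j) hij hj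
    · omega
    rcases i with _ | i
    · refine hlam (U j) fun e he hcr => ?_
      have h6 := h4 e
      have h7 : remCap ends c U₀ e = 0 := by simp [remCap, he]
      rw [h7, Nat.le_zero, Finset.card_eq_zero] at h6
      exact (Finset.filter_eq_empty_iff.1 h6) (Finset.mem_range.2 (by omega : j < n)) hcr
    · exact h3 i j (by omega) (by omega)
  · intro e
    rw [hcount, hrem e]
    exact Nat.add_le_add_right (h4 e) _
  · intro e he
    rw [hcount, hrem e, h5 e he]

end Packing

section Selection

theorem exists_independent {ι : Type} [DecidableEq ι] {r : ι → ι → Prop} (hr : ∀ i j, r i j → r j i) (d m : ℕ) :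
    ∀ I : Finset ι, I.card = m →
    (∀ S ⊆ I, S.Nonempty → ∃ i ∈ S, (S.filter fun j => j ≠ i ∧ r i j).card ≤ d) →
    ∃ T ⊆ I, (∀ i ∈ T, ∀ j ∈ T, i ≠ j → ¬ r i j) ∧ I.card ≤ (d + 1) * T.card := by
  induction m using Nat.strong_induction_on with
  | _ m ih =>
  intro I hm hI
  rcases I.eq_empty_or_nonempty with rfl | hne
  · exact ⟨∅, Finset.empty_subset _, by simp, by simp⟩
  obtain ⟨i, hi, hd⟩ := hI I le_rfl hne
  set N := I.filter fun j => j ≠ i ∧ r i j with hN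
  have hiN : i ∉ N := fun h => (Finset.mem_filter.1 h).2.1 rfl
  have hins : insert i N ⊆ I := Finset.insert_subset hi (Finset.filter_subset _ _)
  have hcard : (I \ insert i N).card + (N.card + 1) = I.card := by
    rw [← Finset.card_insert_of_notMem hiN, Finset.card_sdiff_add_card_eq_card hins]
  obtain ⟨T, hT, hind, hTc⟩ := ih (I \ insert i N).card (by omega) _ rfl
    fun S hS => hI S (hS.trans Finset.sdiff_subset)
  have hmem : ∀ j ∈ T, j ∈ I ∧ j ≠ i ∧ ¬ r i j := by
    intro j hj
    obtain ⟨h1, h2⟩ := Finset.mem_sdiff.1 (hT hj)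
    rw [Finset.mem_insert, not_or] at h2
    exact ⟨h1, h2.1, fun h => h2.2 (Finset.mem_filter.2 ⟨h1, h2.1, h⟩)⟩
  refine ⟨insert i T, Finset.insert_subset hi fun j hj => (hmem j hj).1, ?_, ?_⟩
  · intro j hj k hk hjk
    rcases Finset.mem_insert.1 hj with rfl | hjT <;>
      rcases Finset.mem_insert.1 hk with rfl | hkT
    · exact absurd rfl hjk
    · exact (hmem k hkT).2.2
    · exact fun h => (hmem j hjT).2.2 (hr _ _ h)
    · exact hind j hjT k hkT hjk
  · rw [Finset.card_insert_of_notMem fun h => (hmem i h).2.1 rfl, mul_add, mul_one]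
    omega

variable {V ε : Type} {ends : ε → Sym2 V} {n M : ℕ} {U : ℕ → Set V}

/-- The number of members of a laminar family from the `i`-th onwards that contain it. -/
def depth (U : ℕ → Set V) (n i : ℕ) : ℕ :=
  ((Finset.range n).filter fun j => i ≤ j ∧ U i ⊆ U j).card

theorem depth_eq (hlam : ∀ i j, i < j → j < n → U i ⊆ U j ∨ Disjoint (U i) (U j)) {i : ℕ} {u : V}
    (hu : u ∈ U i) :
    depth U n i = ((Finset.range n).filter fun j => i ≤ j ∧ u ∈ U j).card := by
  unfold depth
  congr 1
  ext j
  simp only [Finset.mem_filter, Finset.mem_range]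
  refine and_congr_right fun hj => and_congr_right fun hij => ⟨fun h => h hu, fun h => ?_⟩
  rcases hij.eq_or_lt with rfl | hij
  · exact le_rfl
  · exact (hlam i j hij hj).resolve_right fun h' => Set.disjoint_left.1 h' hu h

theorem disjoint_of_depth_eq
    (hlam : ∀ i j, i < j → j < n → U i ⊆ U j ∨ Disjoint (U i) (U j)) {i j : ℕ} (hij : i < j)
    (hj : j < n) (h : depth U n i = depth U n j) : Disjoint (U i) (U j) := by
  refine (hlam i j hij hj).resolve_left fun hsub => ?_
  refine (Finset.card_lt_card (?_ : (Finset.range n).filter (fun k => j ≤ k ∧ U j ⊆ U k) ⊂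
    (Finset.range n).filter fun k => i ≤ k ∧ U i ⊆ U k)).ne h.symm
  refine Finset.ssubset_iff_of_subset (fun k hk => ?_) |>.2 ⟨i, ?_, ?_⟩
  · simp only [Finset.mem_filter] at hk ⊢
    exact ⟨hk.1, by omega, hsub.trans hk.2.2⟩
  · simp only [Finset.mem_filter, Finset.mem_range]
    exact ⟨by omega, le_rfl, le_rfl⟩
  · simp only [Finset.mem_filter, not_and]
    intro _ h
    omega

theorem depth_eq_of_crosses
    (hlam : ∀ i j, i < j → j < n → U i ⊆ U j ∨ Disjoint (U i) (U j)) {e : ε}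
    (hM : ((Finset.range n).filter fun i => Crosses (ends e) (U i)).card ≤ M)
    {i i' : ℕ} (hii : i < i') (hi' : i' < n) (hmod : depth U n i ≡ depth U n i' [MOD M])
    (hc : Crosses (ends e) (U i)) (hc' : Crosses (ends e) (U i')) :
    depth U n i = depth U n i' := by
  obtain ⟨u, v, he, hu, hv⟩ := hc
  rw [he] at hM hc'
  simp only [crosses_mk] at hM hc'
  have hd := depth_eq hlam hu
  set A := (Finset.range n).filter fun j => i ≤ j ∧ u ∈ U j with hA
  by_cases hu' : u ∈ U i'
  · have hv' : v ∉ U i' := by tauto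
    have hd' := depth_eq hlam hu'
    set B := (Finset.range n).filter fun j => i' ≤ j ∧ u ∈ U j with hB
    have hBA : B ⊆ A := fun j hj => by
      simp only [hA, hB, Finset.mem_filter] at hj ⊢
      exact ⟨hj.1, by omega, hj.2.2⟩
    have hAB := Finset.card_sdiff_add_card_eq_card hBA
    have hiAB : i ∈ A \ B := by
      simp only [hA, hB, Finset.mem_sdiff, Finset.mem_filter, Finset.mem_range, not_and]
      exact ⟨⟨by omega, le_rfl, hu⟩, fun _ _ => by omega⟩
    have hpos : 0 < (A \ B).card := Finset.card_pos.2 ⟨i, hiAB⟩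
    have hdvd : M ∣ (A \ B).card := by
      have h1 := (Nat.modEq_iff_dvd' (by omega : depth U n i' ≤ depth U n i)).1 hmod.symm
      rwa [show depth U n i - depth U n i' = (A \ B).card by omega] at h1
    have hle := Nat.le_of_dvd hpos hdvd
    have hi'AB : i' ∉ A \ B := by
      simp only [hA, hB, Finset.mem_sdiff, Finset.mem_filter, Finset.mem_range]
      exact fun h => h.2 ⟨hi', le_rfl, hu'⟩
    have hsub : insert i' (A \ B) ⊆
        (Finset.range n).filter fun i => ¬ (u ∈ U i ↔ v ∈ U i) := by
      refine Finset.insert_subset ?_ fun j hj => ?_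
      · simp only [Finset.mem_filter, Finset.mem_range]
        exact ⟨hi', hc'⟩
      · simp only [hA, hB, Finset.mem_sdiff, Finset.mem_filter, Finset.mem_range, not_and] at hj ⊢
        obtain ⟨⟨hjn, hij, huj⟩, h⟩ := hj
        have hji' : j < i' := by
          by_contra h'
          exact h hjn (by omega) huj
        have hjs := (hlam j i' hji' hi').resolve_right
          fun h' => Set.disjoint_left.1 h' huj hu'
        refine ⟨hjn, fun h' => hv' (hjs (h'.1 huj))⟩
    have h2 := Finset.card_le_card hsub
    rw [Finset.card_insert_of_notMem hi'AB] at h2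
    omega
  · have hv' : v ∈ U i' := by tauto
    have hd' := depth_eq hlam hv'
    set B := (Finset.range n).filter fun j => i' ≤ j ∧ v ∈ U j with hB
    have hA' := Finset.card_filter_add_card_filter_not (s := A) fun j => v ∈ U j
    have hB' := Finset.card_filter_add_card_filter_not (s := B) fun j => u ∈ U j
    have hAB : A.filter (fun j => v ∈ U j) = B.filter fun j => u ∈ U j := by
      ext j
      simp only [hA, hB, Finset.mem_filter, Finset.mem_range]
      constructor
      · rintro ⟨⟨hj, hij, huj⟩, hvj⟩
        refine ⟨⟨hj, ?_, hvj⟩, huj⟩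
        by_contra hlt
        exact (hlam j i' (by omega) hi').elim (fun h => hu' (h huj))
          fun h => Set.disjoint_left.1 h hvj hv'
      · rintro ⟨⟨hj, hij, hvj⟩, huj⟩
        exact ⟨⟨hj, by omega, huj⟩, hvj⟩
    have h1 : 0 < (A.filter fun j => ¬ v ∈ U j).card := Finset.card_pos.2 ⟨i, by
      simp only [hA, Finset.mem_filter, Finset.mem_range]
      exact ⟨⟨by omega, le_rfl, hu⟩, hv⟩⟩
    have h2 : 0 < (B.filter fun j => ¬ u ∈ U j).card := Finset.card_pos.2 ⟨i', by
      simp only [hB, Finset.mem_filter, Finset.mem_range]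
      exact ⟨⟨by omega, le_rfl, hv'⟩, hu'⟩⟩
    have h3 : Disjoint (A.filter fun j => ¬ v ∈ U j) (B.filter fun j => ¬ u ∈ U j) := by
      refine Finset.disjoint_left.2 fun j hj hj' => ?_
      simp only [hA, hB, Finset.mem_filter] at hj hj'
      exact hj'.2 hj.1.2.2
    have h4 : (A.filter fun j => ¬ v ∈ U j) ∪ (B.filter fun j => ¬ u ∈ U j) ⊆
        (Finset.range n).filter fun i => ¬ (u ∈ U i ↔ v ∈ U i) := by
      intro j hj
      simp only [hA, hB, Finset.mem_union, Finset.mem_filter] at hj ⊢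
      tauto
    have h5 := Finset.card_le_card h4
    rw [Finset.card_union_of_disjoint h3] at h5
    rw [hAB] at hA'
    rcases le_total (depth U n i) (depth U n i') with h | h
    · have h6 := (Nat.modEq_iff_dvd' h).1 hmod
      have := Nat.eq_zero_of_dvd_of_lt h6 (by omega)
      omega
    · have h6 := (Nat.modEq_iff_dvd' h).1 hmod.symm
      have := Nat.eq_zero_of_dvd_of_lt h6 (by omega)
      omega

/-- Some edge lies in the cuts of both `A` and `B`. -/
def CutsMeet (ends : ε → Sym2 V) (A B : Set V) : Prop :=
  ∃ e, Crosses (ends e) A ∧ Crosses (ends e) B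

theorem CutsMeet.touch {A B : Set V} (h : CutsMeet ends A B) (hd : Disjoint A B) :
    Touch ends A B := by
  obtain ⟨e, ⟨u, v, he, hu, hv⟩, h⟩ := h
  rw [he, crosses_mk] at h
  have : u ∉ B := Set.disjoint_left.1 hd hu
  exact ⟨e, u, hu, v, by tauto, he⟩

theorem IsPlanar.exists_disjoint_cuts (hpl : IsPlanar ends) (hM0 : 0 < M)
    (hconn : ∀ i < n, ConnectedOn ends (U i))
    (hlam : ∀ i j, i < j → j < n → U i ⊆ U j ∨ Disjoint (U i) (U j))
    (hM : ∀ e, ((Finset.range n).filter fun i => Crosses (ends e) (U i)).card ≤ M) :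
    ∃ T ⊆ Finset.range n, (∀ i ∈ T, ∀ j ∈ T, i ≠ j → ¬ CutsMeet ends (U i) (U j)) ∧
      n ≤ 8 * M * T.card := by
  obtain ⟨θ, hθ⟩ : ∃ θ, n ≤ M * ((Finset.range n).filter fun i => depth U n i % M = θ).card := by
    by_contra! h
    have h1 := Finset.card_eq_sum_card_fiberwise (s := Finset.range n) (t := Finset.range M)
      (f := fun i => depth U n i % M)
      fun i _ => Finset.mem_coe.2 (Finset.mem_range.2 (Nat.mod_lt _ hM0))
    have h2 := Finset.sum_lt_sum_of_nonempty (s := Finset.range M)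
      ⟨0, Finset.mem_range.2 hM0⟩ fun θ _ => h θ
    rw [← Finset.mul_sum, ← h1, Finset.sum_const, Finset.card_range, Finset.card_range,
      smul_eq_mul] at h2
    exact lt_irrefl _ h2
  set I := (Finset.range n).filter fun i => depth U n i % M = θ with hI
  have hIn : ∀ i ∈ I, i < n := fun i hi => Finset.mem_range.1 (Finset.mem_filter.1 hi).1
  have hsymm : ∀ A B, CutsMeet ends A B → CutsMeet ends B A := fun A B ⟨e, h, h'⟩ => ⟨e, h', h⟩
  have hdepth : ∀ i ∈ I, ∀ j ∈ I, i ≠ j → CutsMeet ends (U i) (U j) →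
      depth U n i = depth U n j := by
    intro i hi j hj hij ⟨e, h, h'⟩
    have hmod : depth U n i ≡ depth U n j [MOD M] :=
      (Finset.mem_filter.1 hi).2.trans (Finset.mem_filter.1 hj).2.symm
    rcases lt_or_gt_of_ne hij with hij | hij
    · exact depth_eq_of_crosses hlam (hM e) hij (hIn j hj) hmod h h'
    · exact (depth_eq_of_crosses hlam (hM e) hij (hIn i hi) hmod.symm h' h).symm
  have hdisj : ∀ i ∈ I, ∀ j ∈ I, i ≠ j → depth U n i = depth U n j → Disjoint (U i) (U j) := by
    intro i hi j hj hij h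
    rcases lt_or_gt_of_ne hij with hij | hij
    · exact disjoint_of_depth_eq hlam hij (hIn j hj) h
    · exact (disjoint_of_depth_eq hlam hij (hIn i hi) h.symm).symm
  obtain ⟨T, hT, hind, hcard⟩ := exists_independent (r := fun i j => CutsMeet ends (U i) (U j))
    (fun i j => hsymm _ _) 7 I.card I rfl (by
      rintro S hS ⟨i₀, hi₀⟩
      set S' := S.filter fun i => depth U n i = depth U n i₀ with hS'
      have hS'I : ∀ i ∈ S', i ∈ I ∧ depth U n i = depth U n i₀ := fun i hi =>
        ⟨hS (Finset.mem_filter.1 hi).1, (Finset.mem_filter.1 hi).2⟩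
      have hd : ∀ i ∈ S', ∀ j ∈ S', i ≠ j → Disjoint (U i) (U j) := fun i hi j hj hij =>
        hdisj i (hS'I i hi).1 j (hS'I j hj).1 hij ((hS'I i hi).2.trans (hS'I j hj).2.symm)
      have hne : ∀ i ∈ S', ∀ j ∈ S', i ≠ j → U i ≠ U j := by
        intro i hi j hj hij h
        obtain ⟨x, hx⟩ := (hconn i (hIn i (hS'I i hi).1)).1
        exact Set.disjoint_left.1 (hd i hi j hj hij) hx (h ▸ hx)
      obtain ⟨A, hA, hA7⟩ := hpl.exists_degree_le_seven (S'.image U)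
        ⟨U i₀, Finset.mem_image_of_mem _ (Finset.mem_filter.2 ⟨hi₀, rfl⟩)⟩ ⟨by
          intro A hA
          obtain ⟨i, hi, rfl⟩ := Finset.mem_image.1 hA
          exact hconn i (hIn i (hS'I i hi).1), by
          intro A hA B hB hAB
          obtain ⟨i, hi, rfl⟩ := Finset.mem_image.1 hA
          obtain ⟨j, hj, rfl⟩ := Finset.mem_image.1 hB
          exact hd i hi j hj fun h => hAB (by rw [h])⟩
      obtain ⟨i, hi, rfl⟩ := Finset.mem_image.1 hA
      refine ⟨i, (Finset.mem_filter.1 hi).1, le_trans ?_ hA7⟩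
      have hnbr : ∀ j, j ∈ S ∧ j ≠ i ∧ CutsMeet ends (U i) (U j) →
          j ∈ S' ∧ j ≠ i ∧ CutsMeet ends (U i) (U j) := by
        rintro j ⟨hjS, hji, hm⟩
        refine ⟨Finset.mem_filter.2 ⟨hjS, ?_⟩, hji, hm⟩
        rw [← (hS'I i hi).2]
        exact (hdepth i (hS'I i hi).1 j (hS hjS) hji.symm hm).symm
      refine Finset.card_le_card_of_injOn U (fun j hj => ?_) fun j hj k hk h => ?_
      · obtain ⟨h1, h2, h3⟩ := hnbr j (Finset.mem_filter.1 hj)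
        exact Finset.mem_coe.2 (Finset.mem_filter.2 ⟨Finset.mem_image_of_mem _ h1,
          hne j h1 i hi h2, h3.touch (hd i hi j h1 h2.symm)⟩)
      · by_contra hjk
        exact hne j (hnbr j (Finset.mem_filter.1 hj)).1 k (hnbr k (Finset.mem_filter.1 hk)).1 hjk h)
  refine ⟨T, hT.trans (Finset.filter_subset _ _), hind, hθ.trans ?_⟩
  calc M * I.card ≤ M * ((7 + 1) * T.card) := Nat.mul_le_mul_left _ hcard
    _ = 8 * M * T.card := by ring

end Selection

section Rounding

variable {V ε : Type} {ends : ε → Sym2 V}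

/-- Scaling a fractional solution and rounding it down gives capacities satisfying the cut
condition of `exists_packing`. -/
theorem exists_scaled_capacity [Fintype V] {Dem : Finset ε} {x : ε → ℝ}
    (hx01 : ∀ e ∈ Dem, 0 ≤ x e ∧ x e ≤ 1)
    (hxC : ∀ C : Finset ε, IsCycle ends C → ∑ e ∈ C ∩ Dem, x e ≤ ((C \ Dem).card : ℝ))
    (hs : 0 < ∑ e ∈ Dem, x e) :
    ∃ (q : ℕ) (c : ε → ℕ), 0 < q ∧ (∀ e, c e ≤ 2 * q) ∧ (∀ e, Even (c e)) ∧
      (∀ Z, bd ends Z = 0 → 0 ≤ ∑ e ∈ Z, signedCap Dem c e) ∧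
      (q : ℝ) * ∑ e ∈ Dem, x e ≤ ∑ e ∈ Dem, (c e : ℝ) := by
  obtain ⟨q, hq⟩ := exists_nat_gt (2 * (Dem.card : ℝ) / ∑ e ∈ Dem, x e)
  have hqs : 2 * (Dem.card : ℝ) ≤ q * ∑ e ∈ Dem, x e := ((div_lt_iff₀ hs).1 hq).le
  have hq0 : (0 : ℝ) < q := lt_of_le_of_lt (by positivity) hq
  set p : ε → ℕ := fun e => ⌊(q : ℝ) * x e⌋₊ with hp
  have hp1 : ∀ e ∈ Dem, (p e : ℝ) ≤ q * x e := fun e he =>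
    Nat.floor_le (mul_nonneg hq0.le (hx01 e he).1)
  have hp2 : ∀ e, (q : ℝ) * x e ≤ p e + 1 := fun e => (Nat.lt_floor_add_one _).le
  have hpq : ∀ e ∈ Dem, p e ≤ q := fun e he => by
    have : (p e : ℝ) ≤ q := (hp1 e he).trans (mul_le_of_le_one_right hq0.le (hx01 e he).2)
    exact_mod_cast this
  refine ⟨q, fun e => 2 * if e ∈ Dem then p e else q, by exact_mod_cast hq0, ?_, ?_, ?_, ?_⟩
  · intro e
    by_cases he : e ∈ Dem
    · simpa [he] using hpq e he
    · simp [he]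
  · exact fun e => even_two_mul _
  · intro Z hZ
    refine sum_nonneg_of_isCycle (fun C hC => ?_) Z.card Z rfl hZ
    have h1 : (∑ e ∈ C ∩ Dem, (p e : ℝ)) ≤ q * (C \ Dem).card :=
      calc ∑ e ∈ C ∩ Dem, (p e : ℝ) ≤ ∑ e ∈ C ∩ Dem, q * x e :=
            Finset.sum_le_sum fun e he => hp1 e (Finset.mem_inter.1 he).2
        _ = q * ∑ e ∈ C ∩ Dem, x e := by rw [Finset.mul_sum]
        _ ≤ q * (C \ Dem).card := mul_le_mul_of_nonneg_left (hxC C hC) hq0.le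
    have h2 : ∑ e ∈ C ∩ Dem, (p e : ℤ) ≤ q * (C \ Dem).card := by exact_mod_cast h1
    rw [← Finset.sum_inter_add_sum_sdiff C Dem,
      Finset.sum_congr rfl fun e he => (by
        simp [signedCap, (Finset.mem_inter.1 he).2] :
        signedCap Dem (fun e => 2 * if e ∈ Dem then p e else q) e = -2 * (p e : ℤ)),
      Finset.sum_congr (s₁ := C \ Dem) rfl fun e he => (by
        simp [signedCap, (Finset.mem_sdiff.1 he).2] :
        signedCap Dem (fun e => 2 * if e ∈ Dem then p e else q) e = 2 * (q : ℤ)),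
      ← Finset.mul_sum, Finset.sum_const, nsmul_eq_mul]
    linarith
  · rw [Finset.sum_congr rfl fun e he => (by simp [he] :
      ((2 * if e ∈ Dem then p e else q : ℕ) : ℝ) = 2 * (p e : ℝ)), ← Finset.mul_sum]
    have h1 : ∑ e ∈ Dem, (q : ℝ) * x e ≤ ∑ e ∈ Dem, ((p e : ℝ) + 1) :=
      Finset.sum_le_sum fun e _ => hp2 e
    rw [← Finset.mul_sum, Finset.sum_add_distrib, Finset.sum_const, nsmul_eq_mul, mul_one] at h1
    linarith

/-- Each demand edge of a circuit is charged to a supply edge of the circuit in the same cut. -/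
theorem card_inter_image_le [Fintype V] {Dem : Finset ε} {T : Finset ℕ} {U : ℕ → Set V} {g : ℕ → ε}
    (hg : ∀ i ∈ T, Crosses (ends (g i)) (U i) ∧ ∀ f ∈ Dem, Crosses (ends f) (U i) → f = g i)
    (hT : ∀ i ∈ T, ∀ j ∈ T, i ≠ j → ¬ CutsMeet ends (U i) (U j)) {C : Finset ε}
    (hC : IsCycle ends C) : (C ∩ T.image g).card ≤ (C \ Dem).card := by
  refine Finset.card_le_card_of_forall_subsingleton
    (fun e f => ∃ i ∈ T, g i = e ∧ Crosses (ends f) (U i)) (fun e he => ?_) ?_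
  · obtain ⟨heC, he⟩ := Finset.mem_inter.1 he
    obtain ⟨i, hi, rfl⟩ := Finset.mem_image.1 he
    obtain ⟨hc, huniq⟩ := hg i hi
    have hmem : g i ∈ C.filter fun e => Crosses (ends e) (U i) := Finset.mem_filter.2 ⟨heC, hc⟩
    obtain ⟨f, hf, hne⟩ : ∃ f ∈ C.filter fun e => Crosses (ends e) (U i), f ≠ g i := by
      by_contra! h
      have hev := even_card_crosses hC.bd_eq_zero (U i)
      rw [Finset.eq_singleton_iff_unique_mem.2 ⟨hmem, h⟩, Finset.card_singleton] at hev
      exact absurd hev (by decide)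
    obtain ⟨hfC, hfc⟩ := Finset.mem_filter.1 hf
    exact ⟨f, Finset.mem_sdiff.2 ⟨hfC, fun h => hne (huniq f h hfc)⟩, i, hi, rfl, hfc⟩
  · rintro f - e ⟨-, i, hi, rfl, hfi⟩ e' ⟨-, j, hj, rfl, hfj⟩
    by_contra hne
    exact hT i hi j hj (fun h => hne (by rw [h])) ⟨f, hfi, hfj⟩

theorem exists_rounding [Fintype V] [Fintype ε] (hpl : IsPlanar ends) {Dem : Finset ε} {x : ε → ℝ}
    (hx01 : ∀ e ∈ Dem, 0 ≤ x e ∧ x e ≤ 1)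
    (hxC : ∀ C : Finset ε, IsCycle ends C → ∑ e ∈ C ∩ Dem, x e ≤ ((C \ Dem).card : ℝ)) :
    ∃ D' ⊆ Dem,
      (∀ C : Finset ε, IsCycle ends C → (C ∩ D').card ≤ (C \ Dem).card) ∧
      (1 / 16 : ℝ) * ∑ e ∈ Dem, x e ≤ (D'.card : ℝ) := by
  rcases le_or_gt (∑ e ∈ Dem, x e) 0 with hs | hs
  · exact ⟨∅, Finset.empty_subset _, fun C _ => by simp, by
      rw [Finset.card_empty, Nat.cast_zero]; linarith⟩
  obtain ⟨q, c, hq, hcq, hceven, hnn, hqc⟩ := exists_scaled_capacity hx01 hxC hs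
  obtain ⟨n, U, hconn, hdem, hlam, hcap, hsat⟩ := exists_packing _ c rfl hnn
    fun Z _ => Finset.even_sum _ fun e _ => hceven e
  obtain ⟨T, hTn, hT, hTc⟩ := hpl.exists_disjoint_cuts (by omega : 0 < 2 * q) hconn hlam
    fun e => (hcap e).trans (hcq e)
  obtain ⟨e₀, -⟩ : Dem.Nonempty := by
    by_contra h
    rw [Finset.not_nonempty_iff_eq_empty.1 h, Finset.sum_empty] at hs
    exact lt_irrefl _ hs
  have : Nonempty ε := ⟨e₀⟩
  choose! g hgDem hgc hguniq using hdem
  have hTlt : ∀ i ∈ T, i < n := fun i hi => Finset.mem_range.1 (hTn hi)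
  have hcn : ∑ e ∈ Dem, c e = n := by
    rw [Finset.sum_congr rfl fun e he => (hsat e he).symm]
    simp only [Finset.card_filter]
    rw [Finset.sum_comm]
    simp only [← Finset.card_filter]
    rw [Finset.sum_congr rfl fun i hi => (?_ : _ = 1), Finset.sum_const, Finset.card_range,
      smul_eq_mul, mul_one]
    have hi' := Finset.mem_range.1 hi
    refine Finset.card_eq_one.2 ⟨g i, Finset.eq_singleton_iff_unique_mem.2
      ⟨Finset.mem_filter.2 ⟨hgDem i hi', hgc i hi'⟩, fun f hf => ?_⟩⟩
    exact hguniq i hi' f (Finset.mem_filter.1 hf).1 (Finset.mem_filter.1 hf).2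
  refine ⟨T.image g, ?_, fun C hC => card_inter_image_le
    (fun i hi => ⟨hgc i (hTlt i hi), hguniq i (hTlt i hi)⟩) hT hC, ?_⟩
  · intro e he
    obtain ⟨i, hi, rfl⟩ := Finset.mem_image.1 he
    exact hgDem i (hTlt i hi)
  · rw [Finset.card_image_of_injOn]
    · have h1 : (n : ℝ) ≤ 8 * (2 * q) * T.card := by exact_mod_cast hTc
      have h2 : ∑ e ∈ Dem, (c e : ℝ) = n := by exact_mod_cast hcn
      have hq' : (0 : ℝ) < q := by exact_mod_cast hq
      have h3 : (q : ℝ) * ∑ e ∈ Dem, x e ≤ q * (16 * T.card) := by linarith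
      have h4 := le_of_mul_le_mul_left h3 hq'
      linarith
    · intro i hi j hj hij
      by_contra hne
      exact hT i hi j hj hne ⟨g i, hgc i (hTlt i hi), hij ▸ hgc j (hTlt j hj)⟩

end Rounding

/-- rounding the nonnegative cycle LP: any feasible fractional solution `x`
yields a feasible `NonNegativeCycles` solution `D' ⊆ D` of cardinality at least
`(1/16) ∑_{e ∈ D} x_e`. -/
theorem stmt2 {V ε : Type} [Fintype V] [DecidableEq V] [Fintype ε] [DecidableEq ε]
    (ends : ε → Sym2 V) (Dem : Finset ε)
    (hplanar : IsPlanar ends)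
    (x : ε → ℝ)
    (hx01 : ∀ e ∈ Dem, 0 ≤ x e ∧ x e ≤ 1)
    (hxC : ∀ C : Finset ε, IsCycle ends C → ∑ e ∈ C ∩ Dem, x e ≤ ((C \ Dem).card : ℝ)) :
    ∃ D' ⊆ Dem,
      (∀ C : Finset ε, IsCycle ends C → (C ∩ D').card ≤ (C \ Dem).card) ∧
      (1 / 16 : ℝ) * ∑ e ∈ Dem, x e ≤ (D'.card : ℝ) := by
  rename_i _ _ _ hdec
  obtain rfl : hdec = fun a b => Classical.propDecidable (a = b) := Subsingleton.elim _ _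
  exact exists_rounding hplanar hx01 hxC

end
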